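/- Let X be a set of 2n points in general position in the plane such that at most n+1 points of X are extreme points of the convex hull of X, and let H be a set of exactly n edges of X such that no non-crossing perfect matching of X avoids H. Let e = {u,v} ∈ H be a leaf edge of the tree determined by H (i.e., at least one of u, v is an endpoint of no other edge of H), and let l be the line through u and v. Then for every other edge {x,y} ∈ H with {x,y} ≠ {u,v}, the closed segment xy does not intersect the line l. -/

import Mathlib

open MeasureTheory Set Filter

noncomputable section

abbrev Pt : Type := ℝ × ℝ

/-- A finite point set is in general position: no three distinct points are collinear. -/
def GenPos (X : Finset Pt) : Prop :=
  ∀ a ∈ X, ∀ b ∈ X, ∀ c ∈ X, a ≠ b → a ≠ c → b ≠ c → ¬ Collinear ℝ ({a, b, c} : Set Pt)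

/-- `e` is an edge of `X`: an unordered pair of distinct points of `X`. -/
def IsEdgeOf (X : Finset Pt) (e : Sym2 Pt) : Prop :=
  ¬ e.IsDiag ∧ ∀ p ∈ e, p ∈ X

/-- The closed segment joining the two points of an unordered pair. -/
def edgeSeg (e : Sym2 Pt) : Set Pt :=
  Sym2.lift ⟨fun u v => segment ℝ u v, fun u v => segment_symm ℝ u v⟩ e

/-- `M` is a non-crossing perfect matching of `X`: a partition of `X` into unordered pairs
whose closed segments are pairwise disjoint. -/
def IsNCMatching (X : Finset Pt) (M : Finset (Sym2 Pt)) : Prop :=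
  (∀ e ∈ M, IsEdgeOf X e) ∧
  (∀ p ∈ X, ∃! e, e ∈ M ∧ p ∈ e) ∧
  (M : Set (Sym2 Pt)).Pairwise fun e f => Disjoint (edgeSeg e) (edgeSeg f)

/-- The matching `M` avoids the edge set `S`. -/
def Avoids (M S : Finset (Sym2 Pt)) : Prop := ∀ e ∈ M, e ∉ S

/-- The signed cross product determining on which side of the oriented line through `u` and `v`
the point `w` lies; the line through `u` and `v` is its zero set. -/
def cross (u v w : Pt) : ℝ :=
  (v.1 - u.1) * (w.2 - u.2) - (v.2 - u.2) * (w.1 - u.1)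

/-- Every three distinct points of `X` have nonzero cross product. -/
def CrossGen (X : Finset Pt) : Prop :=
  ∀ a ∈ X, ∀ b ∈ X, ∀ c ∈ X, a ≠ b → a ≠ c → b ≠ c → cross a b c ≠ 0

/-- `X` has a non-crossing perfect matching that avoids `H`. -/
def Avoidable (X : Finset Pt) (H : Finset (Sym2 Pt)) : Prop :=
  ∃ M, IsNCMatching X M ∧ Avoids M H

theorem GenPos.crossGen {X : Finset Pt} (h : GenPos X) : CrossGen X := by
  intro a ha b hb c hc hab hac hbc h0
  apply h a ha b hb c hc hab hac hbc
  rw [collinear_iff_of_mem (p₀ := a) (by simp)]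
  have hpos : (b.1 - a.1) ^ 2 + (b.2 - a.2) ^ 2 ≠ 0 := by
    intro h
    apply hab
    have h1 : b.1 - a.1 = 0 := by nlinarith [sq_nonneg (b.1 - a.1), sq_nonneg (b.2 - a.2)]
    have h2 : b.2 - a.2 = 0 := by nlinarith [sq_nonneg (b.1 - a.1), sq_nonneg (b.2 - a.2)]
    ext <;> linarith
  unfold cross at h0
  refine ⟨b - a, ?_⟩
  simp only [Set.mem_insert_iff, Set.mem_singleton_iff]
  rintro p (rfl | rfl | rfl)
  · exact ⟨0, by simp⟩
  · exact ⟨1, by simp⟩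
  · refine ⟨((b.1 - a.1) * (p.1 - a.1) + (b.2 - a.2) * (p.2 - a.2)) /
      ((b.1 - a.1) ^ 2 + (b.2 - a.2) ^ 2), ?_⟩
    ext
    · simp only [vadd_eq_add, Prod.fst_add, Prod.smul_fst, Prod.fst_sub, smul_eq_mul]
      field_simp
      linear_combination (-(b.2 - a.2)) * h0
    · simp only [vadd_eq_add, Prod.snd_add, Prod.smul_snd, Prod.snd_sub, smul_eq_mul]
      field_simp
      linear_combination (b.1 - a.1) * h0

theorem CrossGen.mono {X Y : Finset Pt} (h : CrossGen X) (hY : Y ⊆ X) : CrossGen Y :=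
  fun a ha b hb c hc => h a (hY ha) b (hY hb) c (hY hc)

/-- The Euclidean distance in the plane. -/
def euclDist (a b : Pt) : ℝ :=
  dist (Complex.equivRealProdCLM.symm a) (Complex.equivRealProdCLM.symm b)

theorem euclDist_triangle (a b c : Pt) : euclDist a c ≤ euclDist a b + euclDist b c :=
  dist_triangle _ _ _

theorem mem_segment_iff_euclDist {a b c : Pt} :
    euclDist a b + euclDist b c = euclDist a c ↔ b ∈ segment ℝ a c := by
  unfold euclDist
  rw [dist_add_dist_eq_iff, ← mem_segment_iff_wbtw]
  have h := image_segment ℝ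
    (Complex.equivRealProdCLM.symm.toLinearEquiv.toLinearMap.toAffineMap) a c
  have h' : segment ℝ (Complex.equivRealProdCLM.symm a) (Complex.equivRealProdCLM.symm c) =
      Complex.equivRealProdCLM.symm '' segment ℝ a c := h.symm
  rw [h']
  exact Complex.equivRealProdCLM.symm.injective.mem_set_image

theorem cross_eq_zero_of_mem_segment {a b o : Pt} (h : o ∈ segment ℝ a b) : cross a b o = 0 := by
  obtain ⟨s, t, _, _, hst, rfl⟩ := h
  simp only [cross, Prod.fst_add, Prod.smul_fst, Prod.snd_add, Prod.smul_snd, smul_eq_mul]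
  obtain rfl : s = 1 - t := by linarith
  ring

theorem eq_of_mem_segments {a b d o : Pt} (h : cross a b d ≠ 0) (h1 : o ∈ segment ℝ a b)
    (h2 : o ∈ segment ℝ a d) : o = a := by
  obtain ⟨s, t, _, _, hst, rfl⟩ := h1
  obtain rfl : s = 1 - t := by linarith
  have h3 := cross_eq_zero_of_mem_segment h2
  have h4 : t * cross a b d = 0 := by
    simp only [cross, Prod.fst_add, Prod.smul_fst, Prod.snd_add, Prod.smul_snd,
      smul_eq_mul] at h3 ⊢
    linear_combination -h3
  obtain rfl : t = 0 := (mul_eq_zero.1 h4).resolve_right h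
  simp

/-- Uncrossing two segments strictly decreases their total length. -/
theorem euclDist_uncross {a b c d o : Pt} (hac : a ≠ c) (h1 : cross a b d ≠ 0)
    (h2 : cross c b d ≠ 0) (hab : o ∈ segment ℝ a b) (hcd : o ∈ segment ℝ c d) :
    euclDist a d + euclDist c b < euclDist a b + euclDist c d := by
  have e1 := mem_segment_iff_euclDist.2 hab
  have e2 := mem_segment_iff_euclDist.2 hcd
  have t1 := euclDist_triangle a o d
  have t2 := euclDist_triangle c o b
  by_contra! hlt
  have o1 : o = a := eq_of_mem_segments h1 hab (mem_segment_iff_euclDist.1 (by linarith))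
  have o2 : o = c := eq_of_mem_segments h2 (mem_segment_iff_euclDist.1 (by linarith)) hcd
  exact hac (o1.symm.trans o2)

theorem exists_bichromatic_matching {R B : Finset Pt} (hd : Disjoint R B)
    (hc : R.card = B.card) (hg : CrossGen (R ∪ B)) :
    ∃ M, IsNCMatching (R ∪ B) M ∧ ∀ e ∈ M, ∃ r ∈ R, ∃ b ∈ B, e = s(r, b) := by
  have : Nonempty (R ≃ B) := ⟨Finset.equivOfCardEq hc⟩
  obtain ⟨f, hf⟩ := Finite.exists_min (fun f : R ≃ B => ∑ r : R, euclDist r (f r))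
  have hne : ∀ (r : R) (b : B), (r : Pt) ≠ b := fun r b h =>
    Finset.disjoint_left.1 hd r.2 (h ▸ b.2)
  have hnc : ∀ r r' : R, r ≠ r' →
      Disjoint (segment ℝ (r : Pt) (f r)) (segment ℝ (r' : Pt) (f r')) := by
    intro r r' hrr
    rw [Set.disjoint_left]
    intro o ho ho'
    have hfr : ((f r : B) : Pt) ≠ f r' := fun h => hrr (f.injective (Subtype.ext h))
    have hlt := euclDist_uncross (fun h => hrr (Subtype.ext h))
      (hg r (by simp) (f r) (by simp) (f r') (by simp) (hne _ _) (hne _ _) hfr)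
      (hg r' (by simp) (f r) (by simp) (f r') (by simp) (hne _ _) (hne _ _) hfr) ho ho'
    have hmin := hf ((Equiv.swap r r').trans f)
    have hsum : ∑ x : R, (euclDist x (((Equiv.swap r r').trans f) x) - euclDist x (f x)) =
        (euclDist r (f r') - euclDist r (f r)) + (euclDist r' (f r) - euclDist r' (f r')) := by
      rw [Fintype.sum_eq_add r r' hrr]
      · simp
      · rintro x ⟨h1, h2⟩
        simp [Equiv.swap_apply_of_ne_of_ne h1 h2]
    rw [Finset.sum_sub_distrib] at hsum
    linarith
  refine ⟨Finset.univ.image (fun r : R => s((r : Pt), (f r : Pt))), ⟨?_, ?_, ?_⟩, ?_⟩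
  · intro e he
    obtain ⟨r, -, rfl⟩ := Finset.mem_image.1 he
    refine ⟨by simpa using hne r (f r), ?_⟩
    intro p hp
    rcases Sym2.mem_iff.1 hp with rfl | rfl <;> simp
  · intro p hp
    rcases Finset.mem_union.1 hp with hp | hp
    · refine ⟨s(p, (f ⟨p, hp⟩ : Pt)), ⟨Finset.mem_image.2 ⟨⟨p, hp⟩, by simp, rfl⟩, by simp⟩, ?_⟩
      rintro e ⟨he, hpe⟩
      obtain ⟨r, -, rfl⟩ := Finset.mem_image.1 he
      rcases Sym2.mem_iff.1 hpe with rfl | h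
      · rfl
      · exact absurd h (hne ⟨p, hp⟩ (f r))
    · refine ⟨s((f.symm ⟨p, hp⟩ : Pt), p),
        ⟨Finset.mem_image.2 ⟨f.symm ⟨p, hp⟩, by simp, by simp⟩, by simp⟩, ?_⟩
      rintro e ⟨he, hpe⟩
      obtain ⟨r, -, rfl⟩ := Finset.mem_image.1 he
      rcases Sym2.mem_iff.1 hpe with h | h
      · exact absurd h.symm (hne r ⟨p, hp⟩)
      · have h2 : f.symm ⟨p, hp⟩ = r := by
          rw [Equiv.symm_apply_eq]
          exact Subtype.ext h
        simp only [h2, ← h]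
  · rintro e he e' he' hee
    obtain ⟨r, -, rfl⟩ := Finset.mem_image.1 he
    obtain ⟨r', -, rfl⟩ := Finset.mem_image.1 he'
    exact hnc r r' (by rintro rfl; exact hee rfl)
  · intro e he
    obtain ⟨r, -, rfl⟩ := Finset.mem_image.1 he
    exact ⟨r, r.2, f r, (f r).2, rfl⟩

theorem edgeSeg_subset {C : Set Pt} (hC : Convex ℝ C) {e : Sym2 Pt} (h : ∀ p ∈ e, p ∈ C) :
    edgeSeg e ⊆ C := by
  induction e with
  | _ a b => exact hC.segment_subset (h a (by simp)) (h b (by simp))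

theorem IsNCMatching.union {Y₁ Y₂ : Finset Pt} {M₁ M₂ : Finset (Sym2 Pt)} {C₁ C₂ : Set Pt}
    (h₁ : IsNCMatching Y₁ M₁) (h₂ : IsNCMatching Y₂ M₂) (hC₁ : Convex ℝ C₁) (hC₂ : Convex ℝ C₂)
    (hC : Disjoint C₁ C₂) (hY₁ : ∀ p ∈ Y₁, p ∈ C₁) (hY₂ : ∀ p ∈ Y₂, p ∈ C₂) :
    IsNCMatching (Y₁ ∪ Y₂) (M₁ ∪ M₂) := by
  have hs₁ : ∀ e ∈ M₁, edgeSeg e ⊆ C₁ := fun e he =>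
    edgeSeg_subset hC₁ fun p hp => hY₁ p ((h₁.1 e he).2 p hp)
  have hs₂ : ∀ e ∈ M₂, edgeSeg e ⊆ C₂ := fun e he =>
    edgeSeg_subset hC₂ fun p hp => hY₂ p ((h₂.1 e he).2 p hp)
  have hY : ∀ p ∈ Y₁, p ∉ Y₂ := fun p hp hp' =>
    Set.disjoint_left.1 hC (hY₁ p hp) (hY₂ p hp')
  refine ⟨?_, ?_, ?_⟩
  · intro e he
    rcases Finset.mem_union.1 he with he | he
    · exact ⟨(h₁.1 e he).1, fun p hp => Finset.mem_union_left _ ((h₁.1 e he).2 p hp)⟩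
    · exact ⟨(h₂.1 e he).1, fun p hp => Finset.mem_union_right _ ((h₂.1 e he).2 p hp)⟩
  · intro p hp
    rcases Finset.mem_union.1 hp with hp | hp
    · obtain ⟨e, ⟨he, hpe⟩, hu⟩ := h₁.2.1 p hp
      refine ⟨e, ⟨Finset.mem_union_left _ he, hpe⟩, ?_⟩
      rintro e' ⟨he', hpe'⟩
      rcases Finset.mem_union.1 he' with he' | he'
      · exact hu e' ⟨he', hpe'⟩
      · exact absurd ((h₂.1 e' he').2 p hpe') (hY p hp)
    · obtain ⟨e, ⟨he, hpe⟩, hu⟩ := h₂.2.1 p hp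
      refine ⟨e, ⟨Finset.mem_union_right _ he, hpe⟩, ?_⟩
      rintro e' ⟨he', hpe'⟩
      rcases Finset.mem_union.1 he' with he' | he'
      · exact absurd hp (hY p ((h₁.1 e' he').2 p hpe'))
      · exact hu e' ⟨he', hpe'⟩
  · intro e he e' he' hne
    rw [Finset.mem_coe, Finset.mem_union] at he he'
    rcases he with he | he <;> rcases he' with he' | he'
    · exact h₁.2.2 he he' hne
    · exact hC.mono (hs₁ e he) (hs₂ e' he')
    · exact (hC.mono (hs₁ e' he') (hs₂ e he)).symm
    · exact h₂.2.2 he he' hne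

theorem Avoidable.union {Y₁ Y₂ : Finset Pt} {H : Finset (Sym2 Pt)} {C₁ C₂ : Set Pt}
    (h₁ : Avoidable Y₁ H) (h₂ : Avoidable Y₂ H) (hC₁ : Convex ℝ C₁) (hC₂ : Convex ℝ C₂)
    (hC : Disjoint C₁ C₂) (hY₁ : ∀ p ∈ Y₁, p ∈ C₁) (hY₂ : ∀ p ∈ Y₂, p ∈ C₂) :
    Avoidable (Y₁ ∪ Y₂) H := by
  obtain ⟨M₁, hM₁, ha₁⟩ := h₁
  obtain ⟨M₂, hM₂, ha₂⟩ := h₂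
  refine ⟨M₁ ∪ M₂, hM₁.union hM₂ hC₁ hC₂ hC hY₁ hY₂, fun e he => ?_⟩
  rcases Finset.mem_union.1 he with he | he
  exacts [ha₁ e he, ha₂ e he]

/-- A function on the plane that preserves convex combinations. -/
def PreservesConvexComb (f : Pt → ℝ) : Prop :=
  ∀ x y : Pt, ∀ s t : ℝ, s + t = 1 → f (s • x + t • y) = s * f x + t * f y

theorem PreservesConvexComb.convex_le {f : Pt → ℝ} (hf : PreservesConvexComb f) :
    Convex ℝ {z | f z ≤ 0} := by
  intro x hx y hy s t hs ht hst
  simp only [Set.mem_ofPred_eq] at hx hy ⊢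
  rw [hf x y s t hst]
  nlinarith [mul_nonneg hs (neg_nonneg.2 hx), mul_nonneg ht (neg_nonneg.2 hy)]

theorem PreservesConvexComb.convex_pos {f : Pt → ℝ} (hf : PreservesConvexComb f) :
    Convex ℝ {z | 0 < f z} := by
  intro x hx y hy s t hs ht hst
  simp only [Set.mem_ofPred_eq] at hx hy ⊢
  rw [hf x y s t hst]
  rcases hs.eq_or_lt with rfl | hs
  · obtain rfl : t = 1 := by linarith
    simpa using hy
  · nlinarith [mul_pos hs hx, mul_nonneg ht hy.le]

theorem PreservesConvexComb.convex_lex_pos {f g : Pt → ℝ} (hf : PreservesConvexComb f)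
    (hg : PreservesConvexComb g) : Convex ℝ {z | 0 < f z ∨ f z = 0 ∧ 0 < g z} := by
  intro x hx y hy s t hs ht hst
  simp only [Set.mem_ofPred_eq] at hx hy ⊢
  rw [hf x y s t hst, hg x y s t hst]
  rcases hs.eq_or_lt with rfl | hs
  · obtain rfl : t = 1 := by linarith
    simpa using hy
  rcases ht.eq_or_lt with rfl | ht
  · obtain rfl : s = 1 := by linarith
    simpa using hx
  rcases hx with hx | ⟨hx, hx'⟩ <;> rcases hy with hy | ⟨hy, hy'⟩
  · left; positivity
  · left; rw [hy]; simp; positivity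
  · left; rw [hx]; simp; positivity
  · right; rw [hx, hy]; exact ⟨by simp, by positivity⟩

theorem PreservesConvexComb.neg {f : Pt → ℝ} (hf : PreservesConvexComb f) :
    PreservesConvexComb fun z => -f z := by
  intro x y s t hst
  simp only [hf x y s t hst]
  ring

theorem PreservesConvexComb.convex_lex_nonneg {f g : Pt → ℝ} (hf : PreservesConvexComb f)
    (hg : PreservesConvexComb g) : Convex ℝ {z | 0 < f z ∨ f z = 0 ∧ 0 ≤ g z} := by
  intro x hx y hy s t hs ht hst
  simp only [Set.mem_ofPred_eq] at hx hy ⊢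
  rw [hf x y s t hst, hg x y s t hst]
  rcases hs.eq_or_lt with rfl | hs
  · obtain rfl : t = 1 := by linarith
    simpa using hy
  rcases ht.eq_or_lt with rfl | ht
  · obtain rfl : s = 1 := by linarith
    simpa using hx
  rcases hx with hx | ⟨hx, hx'⟩ <;> rcases hy with hy | ⟨hy, hy'⟩
  · left; positivity
  · left; rw [hy]; simp; positivity
  · left; rw [hx]; simp; positivity
  · right; rw [hx, hy]; exact ⟨by simp, by positivity⟩

theorem preservesConvexComb_cross (u v : Pt) : PreservesConvexComb (cross u v) := by
  intro x y s t hst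
  simp only [cross, Prod.fst_add, Prod.smul_fst, Prod.snd_add, Prod.smul_snd, smul_eq_mul]
  obtain rfl : s = 1 - t := by linarith
  ring

/-- The signed position of the projection of `z` along the direction from `u` to `v`, scaled by the
length of `v - u`. -/
def along (u v z : Pt) : ℝ := (v.1 - u.1) * (z.1 - u.1) + (v.2 - u.2) * (z.2 - u.2)

theorem preservesConvexComb_along (u v : Pt) : PreservesConvexComb (along u v) := by
  intro x y s t hst
  simp only [along, Prod.fst_add, Prod.smul_fst, Prod.snd_add, Prod.smul_snd, smul_eq_mul]
  obtain rfl : s = 1 - t := by linarith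
  ring

theorem Avoidable.of_filter {Y : Finset Pt} {H : Finset (Sym2 Pt)} {f : Pt → ℝ}
    (hf : PreservesConvexComb f) (h₁ : Avoidable (Y.filter fun z => f z ≤ 0) H)
    (h₂ : Avoidable (Y.filter fun z => 0 < f z) H) : Avoidable Y H := by
  have h := h₁.union h₂ hf.convex_le hf.convex_pos
    (Set.disjoint_left.2 fun z h h' => not_lt.2 (show f z ≤ 0 from h) h')
    (fun p hp => (Finset.mem_filter.1 hp).2) (fun p hp => (Finset.mem_filter.1 hp).2)
  convert h using 1
  ext z
  have := le_or_gt (f z) 0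
  simp only [Finset.mem_union, Finset.mem_filter]
  tauto

theorem Avoidable.of_coloring {Y : Finset Pt} {H : Finset (Sym2 Pt)} (hg : CrossGen Y)
    (c : Pt → Prop) [DecidablePred c] (hc : 2 * (Y.filter c).card = Y.card)
    (hH : ∀ a ∈ Y, ∀ b ∈ Y, c a → ¬ c b → s(a, b) ∉ H) : Avoidable Y H := by
  have hu : Y.filter c ∪ Y.filter (fun z => ¬ c z) = Y := Finset.filter_union_filter_not_eq c Y
  have hcard := Finset.card_filter_add_card_filter_not (s := Y) c
  obtain ⟨M, hM, hb⟩ := exists_bichromatic_matching (R := Y.filter c)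
    (B := Y.filter fun z => ¬ c z) (Finset.disjoint_filter_filter_not _ _ _) (by omega)
    (by rwa [hu])
  rw [hu] at hM
  refine ⟨M, hM, fun e he => ?_⟩
  obtain ⟨r, hr, b, hb, rfl⟩ := hb e he
  rw [Finset.mem_filter] at hr hb
  exact hH r hr.1 b hb.1 hr.2 hb.2

/-- If the points outside `I` are two-coloured without bichromatic edges of `H`, and neither colour
takes more than half of `Y`, the points of `I` can be used to balance the colours. -/
theorem Avoidable.of_fill {Y I : Finset Pt} {H : Finset (Sym2 Pt)} (hg : CrossGen Y)
    (hI : ∀ a b, s(a, b) ∈ H → a ∉ I) (c : Pt → Prop) [DecidablePred c] (m : ℕ)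
    (hY : Y.card = 2 * m) (h₁ : (Y.filter fun z => z ∉ I ∧ c z).card ≤ m)
    (h₂ : (Y.filter fun z => z ∉ I ∧ ¬ c z).card ≤ m)
    (hH : ∀ a ∈ Y, ∀ b ∈ Y, c a → ¬ c b → s(a, b) ∉ H) : Avoidable Y H := by
  have e1 := Finset.card_filter_add_card_filter_not (s := Y) (fun z => z ∈ I)
  have e2 := Finset.card_filter_add_card_filter_not (s := Y.filter fun z => z ∉ I) c
  rw [Finset.filter_filter, Finset.filter_filter] at e2
  obtain ⟨J, hJ, hJc⟩ := Finset.exists_subset_card_eq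
    (s := Y.filter fun z => z ∈ I) (n := m - (Y.filter fun z => z ∉ I ∧ c z).card) (by omega)
  have hJ' : ∀ z ∈ J, z ∈ Y ∧ z ∈ I := fun z hz => Finset.mem_filter.1 (hJ hz)
  apply Avoidable.of_coloring hg (fun z => z ∈ J ∨ (z ∉ I ∧ c z))
  · have : Y.filter (fun z => z ∈ J ∨ (z ∉ I ∧ c z)) = J ∪ Y.filter (fun z => z ∉ I ∧ c z) := by
      ext z
      have := hJ' z
      simp only [Finset.mem_filter, Finset.mem_union]
      tauto
    rw [this, Finset.card_union_of_disjoint]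
    · omega
    · rw [Finset.disjoint_left]
      intro z hz hz'
      exact (Finset.mem_filter.1 hz').2.1 (hJ' z hz).2
  · rintro a ha b hb h h' hab
    have h3 := hI a b hab
    have h4 := hI b a (Sym2.eq_swap ▸ hab)
    have h5 := hJ' a
    have h6 := hH a ha b hb
    tauto

theorem exists_threshold {α : Type*} [DecidableEq α] (κ : α → ℝ) (g : α → ℤ) (S : Finset α)
    (hκ : Set.InjOn κ S) (hg : ∀ z ∈ S, |g z| ≤ 1) (M : ℝ) (hM : ∀ z ∈ S, κ z < M) (c : ℤ)
    (hc : 0 ≤ c ∧ c ≤ ∑ z ∈ S, g z ∨ ∑ z ∈ S, g z ≤ c ∧ c ≤ 0) :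
    ∃ t < M, (∀ z ∈ S, κ z ≠ t) ∧ ∑ z ∈ S, (if κ z < t then g z else 0) = c := by
  induction S using Finset.induction_on_max_value κ generalizing M with
  | empty =>
    refine ⟨M - 1, by linarith, by simp, ?_⟩
    simp only [Finset.sum_empty] at hc ⊢
    omega
  | insert a S ha hmax ih =>
    have hlt : ∀ z ∈ S, κ z < κ a := fun z hz => lt_of_le_of_ne (hmax z hz) fun h =>
      ha (hκ (by simp [hz]) (by simp) h ▸ hz)
    have hga := abs_le.1 (hg a (by simp))
    rw [Finset.sum_insert ha] at hc
    by_cases hcc : c = g a + ∑ z ∈ S, g z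
    · have haM := hM a (by simp)
      refine ⟨(κ a + M) / 2, by linarith, ?_, ?_⟩
      · intro z hz
        rcases Finset.mem_insert.1 hz with rfl | hz
        · linarith
        · have := hlt z hz
          linarith
      · rw [Finset.sum_insert ha, if_pos (by linarith), hcc]
        congr 1
        apply Finset.sum_congr rfl
        intro z hz
        have := hlt z hz
        rw [if_pos (by linarith)]
    · obtain ⟨t, ht, h1, h2⟩ := ih (hκ.mono (by simp)) (fun z hz => hg z (by simp [hz])) (κ a) hlt
        (by omega)
      have haM := hM a (by simp)
      refine ⟨t, by linarith, ?_, ?_⟩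
      · intro z hz
        rcases Finset.mem_insert.1 hz with rfl | hz
        · exact ht.ne'
        · exact h1 z hz
      · rw [Finset.sum_insert ha, if_neg (by linarith), h2, zero_add]

theorem sum_sign_eq_zero_iff (Y : Finset Pt) (c : Pt → Prop) [DecidablePred c] :
    ∑ z ∈ Y, (if c z then (1 : ℤ) else -1) = 0 ↔ 2 * (Y.filter c).card = Y.card := by
  have hcard := Finset.card_filter_add_card_filter_not (s := Y) c
  have : ∀ z ∈ Y, (if c z then (1 : ℤ) else -1) = 2 * (if c z then 1 else 0) - 1 := by
    intro z _
    split_ifs <;> rfl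
  rw [Finset.sum_congr rfl this, Finset.sum_sub_distrib, ← Finset.mul_sum, Finset.sum_boole]
  simp only [Finset.sum_const, nsmul_eq_mul, mul_one]
  rw [sub_eq_zero]
  exact_mod_cast Iff.rfl

theorem along_mul_cross_sub (u v z z' : Pt) : along u v z * cross u v z' -
    along u v z' * cross u v z = ((v.1 - u.1) ^ 2 + (v.2 - u.2) ^ 2) * cross u z z' := by
  simp only [along, cross]
  ring

theorem sq_dist_pos {u v : Pt} (h : u ≠ v) : 0 < (v.1 - u.1) ^ 2 + (v.2 - u.2) ^ 2 := by
  by_contra! h0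
  apply h
  have h1 : v.1 - u.1 = 0 := by nlinarith [sq_nonneg (v.1 - u.1), sq_nonneg (v.2 - u.2)]
  have h2 : v.2 - u.2 = 0 := by nlinarith [sq_nonneg (v.1 - u.1), sq_nonneg (v.2 - u.2)]
  ext <;> linarith

/-- If `{u, v}` is the only bichromatic edge of `H` and its line is not balanced, then `H` can be
avoided. -/
theorem Avoidable.of_unbalanced {Y : Finset Pt} {H : Finset (Sym2 Pt)} (hg : CrossGen Y)
    (c : Pt → Prop) [DecidablePred c] (hc : 2 * (Y.filter c).card = Y.card)
    {u v : Pt} (hu : u ∈ Y) (hv : v ∈ Y) (hcu : ¬ c u) (hcv : c v)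
    (hH : ∀ a ∈ Y, ∀ b ∈ Y, c a → ¬ c b → s(a, b) ∈ H → a = v ∧ b = u)
    (hne : (Y.filter fun z => 0 < cross u v z ∧ c z).card ≠
      (Y.filter fun z => 0 < cross u v z ∧ ¬ c z).card) : Avoidable Y H := by
  have huv : u ≠ v := by rintro rfl; exact hcu hcv
  set w : Pt → ℤ := fun z => if c z then 1 else -1 with hw
  set S := (Y.erase u).erase v with hS
  have hsum : ∀ f : Pt → ℤ, ∑ z ∈ Y, f z = f u + f v + ∑ z ∈ S, f z := by
    intro f
    rw [← Finset.add_sum_erase _ _ hu, ← Finset.add_sum_erase (Y.erase u) f (a := v)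
      (Finset.mem_erase.2 ⟨huv.symm, hv⟩), add_assoc]
  have hSm : ∀ z ∈ S, z ∈ Y ∧ z ≠ u ∧ z ≠ v := by
    intro z hz
    simp only [hS, Finset.mem_erase] at hz
    tauto
  have hq : ∀ z ∈ S, cross u v z ≠ 0 := fun z hz => by
    obtain ⟨h1, h2, h3⟩ := hSm z hz
    exact hg u hu v hv z h1 huv h2.symm h3.symm
  have hquu : cross u v u = 0 := by simp [cross]
  have hquv : cross u v v = 0 := by simp [cross]; ring
  have htot : ∑ z ∈ S, w z = 0 := by
    have := (sum_sign_eq_zero_iff Y c).2 hc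
    rw [hsum, if_neg hcu, if_pos hcv] at this
    simpa using this
  set k : ℤ := ∑ z ∈ S, (if 0 < cross u v z then w z else 0) with hk
  have hk0 : k ≠ 0 := by
    intro h0
    apply hne
    have h1 : ∑ z ∈ Y, (if 0 < cross u v z then w z else 0) = 0 := by
      rw [hsum, ← hk, h0, if_neg (by simp [hquu]), if_neg (by simp [hquv])]
      rfl
    rw [← Finset.sum_filter, sum_sign_eq_zero_iff, Finset.filter_filter] at h1
    have h2 := Finset.card_filter_add_card_filter_not (s := Y.filter fun z => 0 < cross u v z) c
    rw [Finset.filter_filter, Finset.filter_filter] at h2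
    omega
  set κ : Pt → ℝ := fun z => along u v z / cross u v z with hκ
  set g : Pt → ℤ := fun z => if 0 < cross u v z then w z else - w z with hgdef
  have hgsum : ∑ z ∈ S, g z = 2 * k := by
    have : ∀ z ∈ S, g z = 2 * (if 0 < cross u v z then w z else 0) - w z := by
      intro z _
      simp only [hgdef]
      split_ifs <;> ring
    rw [Finset.sum_congr rfl this, Finset.sum_sub_distrib, ← Finset.mul_sum, htot, sub_zero]
  have hinj : Set.InjOn κ S := by
    intro z hz z' hz' h
    rw [Finset.mem_coe] at hz hz'
    by_contra hzz
    simp only [hκ] at h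
    rw [div_eq_div_iff (hq z hz) (hq z' hz')] at h
    have h1 := along_mul_cross_sub u v z z'
    rw [h, sub_self] at h1
    rcases mul_eq_zero.1 h1.symm with h1 | h1
    · exact (sq_dist_pos huv).ne' h1
    · exact hg u hu z (hSm z hz).1 z' (hSm z' hz').1 (hSm z hz).2.1.symm
        (hSm z' hz').2.1.symm hzz h1
  obtain ⟨M, hM⟩ : ∃ M, ∀ z ∈ S, κ z < M := by
    obtain ⟨M, hM⟩ := (S.image κ).bddAbove
    exact ⟨M + 1, fun z hz =>
      (hM (Finset.mem_coe.2 (Finset.mem_image_of_mem κ hz))).trans_lt (lt_add_one M)⟩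
  obtain ⟨t, -, ht, hts⟩ := exists_threshold κ g S hinj (fun z _ => by
    simp only [hgdef, hw]
    split_ifs <;> simp) M hM (1 + k) (by rw [hgsum]; omega)
  set φ : Pt → ℝ := fun z => along u v z - t * cross u v z with hφ
  have hφc : PreservesConvexComb φ := by
    intro x y a b hab
    simp only [hφ, preservesConvexComb_along u v x y a b hab,
      preservesConvexComb_cross u v x y a b hab]
    ring
  have hφu : φ u = 0 := by simp [hφ, along, hquu]
  have hφv : 0 < φ v := by
    have := sq_dist_pos huv
    simp only [hφ, along, hquv]
    nlinarith
  have hleft : ∑ z ∈ Y, (if φ z ≤ 0 then w z else 0) = 0 := by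
    rw [hsum, if_pos hφu.le, if_neg (not_le.2 hφv)]
    have : ∀ z ∈ S, (if φ z ≤ 0 then w z else 0) =
        (if κ z < t then g z else 0) + w z - (if 0 < cross u v z then w z else 0) := by
      intro z hz
      have hq0 := hq z hz
      have hkt := ht z hz
      have hal : along u v z = κ z * cross u v z := by
        simp only [hκ]
        field_simp
      have hφz : φ z = (κ z - t) * cross u v z := by
        simp only [hφ, hal]
        ring
      rcases lt_or_gt_of_ne hq0 with h | h <;> rcases lt_or_gt_of_ne hkt with h' | h'
      · have : ¬ φ z ≤ 0 := by rw [hφz]; nlinarith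
        simp [this, h', hgdef, not_lt.2 h.le]
      · have : φ z ≤ 0 := by rw [hφz]; nlinarith
        simp [this, not_lt.2 h'.le, not_lt.2 h.le]
      · have : φ z ≤ 0 := by rw [hφz]; nlinarith
        simp [this, h', h, hgdef]
      · have : ¬ φ z ≤ 0 := by rw [hφz]; nlinarith
        simp [this, not_lt.2 h'.le, h]
    rw [Finset.sum_congr rfl this, Finset.sum_sub_distrib, Finset.sum_add_distrib, hts, htot, ← hk]
    simp [hw, hcu]
  have hright : ∑ z ∈ Y, (if 0 < φ z then w z else 0) = 0 := by
    have h1 := (sum_sign_eq_zero_iff Y c).2 hc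
    have h2 : ∑ z ∈ Y, w z = ∑ z ∈ Y, (if φ z ≤ 0 then w z else 0) +
        ∑ z ∈ Y, (if 0 < φ z then w z else 0) := by
      rw [← Finset.sum_add_distrib]
      apply Finset.sum_congr rfl
      intro z _
      rcases le_or_gt (φ z) 0 with h | h
      · simp [h, not_lt.2 h]
      · simp [h, not_le.2 h]
    rw [hleft, zero_add] at h2
    rw [← h2]
    exact h1
  rw [← Finset.sum_filter, sum_sign_eq_zero_iff] at hleft hright
  apply Avoidable.of_filter hφc
  · apply Avoidable.of_coloring (hg.mono (Finset.filter_subset _ _)) c hleft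
    intro a ha b hb h1 h2 hab
    rw [Finset.mem_filter] at ha hb
    obtain ⟨rfl, rfl⟩ := hH a ha.1 b hb.1 h1 h2 hab
    linarith
  · apply Avoidable.of_coloring (hg.mono (Finset.filter_subset _ _)) c hright
    intro a ha b hb h1 h2 hab
    rw [Finset.mem_filter] at ha hb
    obtain ⟨rfl, rfl⟩ := hH a ha.1 b hb.1 h1 h2 hab
    linarith

theorem Avoidable.of_unbalanced_line {Y : Finset Pt} {H : Finset (Sym2 Pt)} (hg : CrossGen Y)
    (c : Pt → Prop) [DecidablePred c] (hc : 2 * (Y.filter c).card = Y.card)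
    {u v p q : Pt} (hu : u ∈ Y) (hv : v ∈ Y) (hcu : ¬ c u) (hcv : c v)
    (hpq : p = u ∧ q = v ∨ p = v ∧ q = u)
    (hH : ∀ a ∈ Y, ∀ b ∈ Y, c a → ¬ c b → s(a, b) ∈ H → a = v ∧ b = u)
    (hne : (Y.filter fun z => 0 < cross p q z ∧ c z).card ≠
      (Y.filter fun z => 0 < cross p q z ∧ ¬ c z).card) : Avoidable Y H := by
  rcases hpq with ⟨rfl, rfl⟩ | ⟨rfl, rfl⟩
  · exact Avoidable.of_unbalanced hg c hc hu hv hcu hcv hH hne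
  · refine Avoidable.of_unbalanced hg (fun z => ¬ c z) ?_ hv hu (not_not.2 hcv) hcu ?_ ?_
    · have := Finset.card_filter_add_card_filter_not (s := Y) c
      omega
    · intro a ha b hb hca hcb hab
      exact (hH b hb a ha (not_not.1 hcb) hca (Sym2.eq_swap ▸ hab)).symm
    · simp only [not_not]
      exact hne.symm

theorem cross_swap (u v w : Pt) : cross v u w = -cross u v w := by
  simp only [cross]
  ring

theorem cross_rotate (u v w : Pt) : cross v w u = cross u v w := by
  simp only [cross]
  ring

@[simp] theorem cross_self_right (u v : Pt) : cross u v v = 0 := by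
  simp only [cross]
  ring

@[simp] theorem cross_self_left (u v : Pt) : cross u v u = 0 := by
  simp [cross]

/-- The point `b` follows `a` in the counterclockwise order of the vertices of the convex hull. -/
def IsHullEdge (X : Finset Pt) (a b : Pt) : Prop :=
  a ∈ X ∧ b ∈ X ∧ a ≠ b ∧ ∀ c ∈ X, c ≠ a → c ≠ b → 0 < cross a b c

theorem Avoidable.pair {a b : Pt} {H : Finset (Sym2 Pt)} (hab : a ≠ b) (h : s(a, b) ∉ H) :
    Avoidable {a, b} H := by
  apply Avoidable.of_coloring _ (fun z => z = a)
  · rw [Finset.filter_insert, if_pos rfl, Finset.filter_singleton, if_neg hab.symm,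
      Finset.card_pair hab]
    simp
  · rintro x hx y hy rfl hya hxy
    simp only [Finset.mem_insert, Finset.mem_singleton] at hy
    rcases hy with rfl | rfl
    exacts [hya rfl, h hxy]
  · intro x hx y hy z hz h1 h2 h3
    simp only [Finset.mem_insert, Finset.mem_singleton] at hx hy hz
    rcases hx with rfl | rfl <;> rcases hy with rfl | rfl <;> rcases hz with rfl | rfl <;> simp_all

theorem Avoidable.of_isHullEdge {X : Finset Pt} {H : Finset (Sym2 Pt)} {a b : Pt}
    (hab : IsHullEdge X a b) (h : s(a, b) ∉ H) (hX : Avoidable (X \ {a, b}) H) :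
    Avoidable X H := by
  obtain ⟨ha, hb, hne, hpos⟩ := hab
  apply Avoidable.of_filter (preservesConvexComb_cross a b)
  · convert Avoidable.pair hne h using 1
    ext z
    simp only [Finset.mem_filter, Finset.mem_insert, Finset.mem_singleton]
    constructor
    · rintro ⟨hz, hz'⟩
      by_contra! hzz
      exact absurd (hpos z hz hzz.1 hzz.2) (not_lt.2 hz')
    · rintro (rfl | rfl) <;> simp [ha, hb]
  · convert hX using 1
    ext z
    simp only [Finset.mem_filter, Finset.mem_sdiff, Finset.mem_insert, Finset.mem_singleton]
    constructor
    · rintro ⟨hz, hz'⟩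
      refine ⟨hz, ?_⟩
      rintro (rfl | rfl) <;> simp at hz'
    · rintro ⟨hz, hz'⟩
      push Not at hz'
      exact ⟨hz, hpos z hz hz'.1 hz'.2⟩

theorem IsHullEdge.right_unique {X : Finset Pt} {a b b' : Pt} (h : IsHullEdge X a b)
    (h' : IsHullEdge X a b') : b = b' := by
  by_contra hne
  have h1 := h.2.2.2 b' h'.2.1 h'.2.2.1.symm (Ne.symm hne)
  have h2 := h'.2.2.2 b h.2.1 h.2.2.1.symm hne
  rw [← cross_rotate, cross_swap] at h2
  rw [← cross_rotate] at h1
  have := cross_rotate a b b'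
  have := cross_rotate b b' a
  simp only [cross] at *
  linarith

theorem IsHullEdge.subset_of_symm {X : Finset Pt} {a b : Pt} (h : IsHullEdge X a b)
    (h' : IsHullEdge X b a) : X ⊆ {a, b} := by
  intro z hz
  by_contra! hzz
  simp only [Finset.mem_insert, Finset.mem_singleton, not_or] at hzz
  have h1 := h.2.2.2 z hz hzz.1 hzz.2
  have h2 := h'.2.2.2 z hz hzz.2 hzz.1
  rw [cross_swap] at h2
  linarith

theorem IsHullEdge.mem_extremePoints {X : Finset Pt} {a b : Pt} (h : IsHullEdge X a b) :
    a ∈ Set.extremePoints ℝ (convexHull ℝ (X : Set Pt)) := by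
  obtain ⟨ha, hb, hne, hpos⟩ := h
  have hsq := sq_dist_pos hne
  have hsub : convexHull ℝ (X : Set Pt) ⊆
      {z | 0 < cross a b z ∨ cross a b z = 0 ∧ 0 ≤ along a b z} := by
    apply convexHull_min _
      ((preservesConvexComb_cross a b).convex_lex_nonneg (preservesConvexComb_along a b))
    intro z hz
    rw [Set.mem_ofPred_eq]
    by_cases h1 : z = a
    · subst h1
      right
      simp [along]
    by_cases h2 : z = b
    · subst h2
      right
      refine ⟨by simp, ?_⟩
      simp only [along]
      nlinarith
    exact Or.inl (hpos z hz h1 h2)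
  rw [_root_.mem_extremePoints]
  refine ⟨subset_convexHull ℝ _ ha, fun x hx y hy hxy => ?_⟩
  obtain ⟨s, t, hs, ht, hst, hz⟩ := hxy
  have hf := preservesConvexComb_cross a b x y s t hst
  have hg := preservesConvexComb_along a b x y s t hst
  rw [hz] at hf hg
  have hx' := hsub hx
  have hy' := hsub hy
  rw [Set.mem_ofPred_eq] at hx' hy'
  have h0 : cross a b a = 0 := by simp
  have h0' : along a b a = 0 := by simp [along]
  rw [h0] at hf
  rw [h0'] at hg
  have hx0 : 0 ≤ cross a b x := by rcases hx' with h | h <;> linarith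
  have hy0 : 0 ≤ cross a b y := by rcases hy' with h | h <;> linarith
  have hx1 : cross a b x = 0 := by nlinarith [mul_nonneg hs.le hx0, mul_nonneg ht.le hy0]
  have hy1 : cross a b y = 0 := by nlinarith [mul_nonneg hs.le hx0, mul_nonneg ht.le hy0]
  have hx2 : 0 ≤ along a b x := by rcases hx' with h | h <;> linarith
  have hy2 : 0 ≤ along a b y := by rcases hy' with h | h <;> linarith
  have hx3 : along a b x = 0 := by nlinarith [mul_nonneg hs.le hx2, mul_nonneg ht.le hy2]
  have hy3 : along a b y = 0 := by nlinarith [mul_nonneg hs.le hx2, mul_nonneg ht.le hy2]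
  have key : ∀ z, cross a b z = 0 → along a b z = 0 → z = a := by
    intro z h1 h2
    simp only [cross, along] at h1 h2
    have e1 : ((b.1 - a.1) ^ 2 + (b.2 - a.2) ^ 2) * (z.1 - a.1) = 0 := by
      linear_combination (b.1 - a.1) * h2 - (b.2 - a.2) * h1
    have e2 : ((b.1 - a.1) ^ 2 + (b.2 - a.2) ^ 2) * (z.2 - a.2) = 0 := by
      linear_combination (b.2 - a.2) * h2 + (b.1 - a.1) * h1
    have e3 := (mul_eq_zero.1 e1).resolve_left hsq.ne'
    have e4 := (mul_eq_zero.1 e2).resolve_left hsq.ne'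
    ext <;> linarith
  exact ⟨key x hx1 hx3, key y hy1 hy3⟩

theorem IsHullEdge.of_nonneg {X : Finset Pt} {a b : Pt} (hg : CrossGen X) (ha : a ∈ X) (hb : b ∈ X)
    (hab : a ≠ b) (h : ∀ c ∈ X, c ≠ a → c ≠ b → 0 ≤ cross a b c) : IsHullEdge X a b :=
  ⟨ha, hb, hab, fun c hc hca hcb =>
    (h c hc hca hcb).lt_of_ne (hg a ha b hb c hc hab hca.symm hcb.symm).symm⟩

/-- The ray leaving `u` away from `v` either crosses an edge of the convex hull, or `u` is a vertex
of the convex hull. -/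
theorem exists_isHullEdge_beyond {X : Finset Pt} {u v : Pt} (hg : CrossGen X) (hu : u ∈ X)
    (hv : v ∈ X) (huv : u ≠ v) :
    (∃ a b, IsHullEdge X a b ∧ cross v u a < 0 ∧ 0 < cross v u b) ∨
      ((∃ b, IsHullEdge X u b) ∧ ∃ a, IsHullEdge X a u) := by
  set L := X.filter fun z => cross v u z < 0 with hL
  set R := X.filter fun z => 0 < cross v u z with hR
  have hside : ∀ c ∈ X, c ≠ u → c ≠ v → c ∈ L ∨ c ∈ R := by
    intro c hc h1 h2
    rcases lt_or_gt_of_ne (hg v hv u hu c hc huv.symm h2.symm h1.symm) with h | h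
    · exact Or.inl (Finset.mem_filter.2 ⟨hc, h⟩)
    · exact Or.inr (Finset.mem_filter.2 ⟨hc, h⟩)
  have hsq := sq_dist_pos huv
  by_cases hcase : ∃ a ∈ L, ∃ b ∈ R, 0 < cross u a b
  · left
    obtain ⟨a₀, ha₀, b₀, hb₀, hab₀⟩ := hcase
    obtain ⟨⟨a, b⟩, hab, hmax⟩ := (L ×ˢ R).exists_max_image
      (fun z => cross u z.1 z.2 / (cross v u z.2 - cross v u z.1)) ⟨(a₀, b₀), by simp [ha₀, hb₀]⟩
    have h0 := hmax (a₀, b₀) (by simp [ha₀, hb₀])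
    rw [Finset.mem_product] at hab
    have haX := (Finset.mem_filter.1 hab.1).1
    have hbX := (Finset.mem_filter.1 hab.2).1
    have ha := (Finset.mem_filter.1 hab.1).2
    have hb := (Finset.mem_filter.1 hab.2).2
    have ha₁ := (Finset.mem_filter.1 ha₀).2
    have hb₁ := (Finset.mem_filter.1 hb₀).2
    simp only at h0 hmax haX hbX ha hb
    have hpos : 0 < cross u a b := by
      have h1 : 0 < cross u a₀ b₀ / (cross v u b₀ - cross v u a₀) :=
        div_pos hab₀ (by linarith)
      by_contra! h2
      have := div_nonpos_of_nonpos_of_nonneg h2 (show 0 ≤ cross v u b - cross v u a by linarith)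
      linarith
    refine ⟨a, b, IsHullEdge.of_nonneg hg haX hbX (by rintro rfl; linarith) ?_, ha, hb⟩
    intro c hc hca hcb
    by_cases hcu : c = u
    · subst hcu
      rw [cross_rotate]
      exact hpos.le
    by_cases hcv : c = v
    · subst hcv
      have : cross a b c = cross u a b + cross c u b - cross c u a := by
        simp only [cross]
        ring
      linarith
    rcases hside c hc hcu hcv with h | h
    · have h1 := hmax (c, b) (by simp [h, hab.2])
      have h2 := (Finset.mem_filter.1 h).2
      simp only at h1
      rw [div_le_div_iff₀ (by linarith) (by linarith)] at h1
      have : cross u a b * (cross v u b - cross v u c) - cross u c b * (cross v u b - cross v u a) =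
          cross v u b * cross a b c := by
        simp only [cross]
        ring
      nlinarith
    · have h1 := hmax (a, c) (by simp [h, hab.1])
      have h2 := (Finset.mem_filter.1 h).2
      simp only at h1
      rw [div_le_div_iff₀ (by linarith) (by linarith)] at h1
      have : cross u a b * (cross v u c - cross v u a) - cross u a c * (cross v u b - cross v u a) =
          -cross v u a * cross a b c := by
        simp only [cross]
        ring
      nlinarith
  · right
    push Not at hcase
    constructor
    · rcases R.eq_empty_or_nonempty with hRe | hRe
      · refine ⟨v, IsHullEdge.of_nonneg hg hu hv huv ?_⟩
        intro c hc h1 h2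
        have h3 := (hside c hc h1 h2).resolve_right (by simp [hRe])
        have h4 := (Finset.mem_filter.1 h3).2
        rw [cross_swap] at h4
        linarith
      · obtain ⟨b, hb, hmax⟩ := R.exists_min_image (fun z => along u v z / cross v u z) hRe
        have hb' := Finset.mem_filter.1 hb
        have hub : u ≠ b := by
          rintro rfl
          simp at hb'
        refine ⟨b, IsHullEdge.of_nonneg hg hu hb'.1 hub ?_⟩
        intro c hc hcu hcb
        by_cases hcv : c = v
        · subst hcv
          rw [cross_rotate]
          exact hb'.2.le
        rcases hside c hc hcu hcv with h | h
        · have := hcase c h b hb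
          have h2 : cross u b c = -cross u c b := by
            simp only [cross]
            ring
          linarith
        · have h1 := hmax c h
          have h2 := (Finset.mem_filter.1 h).2
          rw [div_le_div_iff₀ hb'.2 h2] at h1
          have h3 := along_mul_cross_sub u v b c
          rw [cross_swap v u b, cross_swap v u c] at h3
          nlinarith
    · rcases L.eq_empty_or_nonempty with hLe | hLe
      · refine ⟨v, IsHullEdge.of_nonneg hg hv hu huv.symm ?_⟩
        intro c hc h1 h2
        have h3 := (hside c hc h2 h1).resolve_left (by simp [hLe])
        exact (Finset.mem_filter.1 h3).2.le
      · obtain ⟨a, ha, hmax⟩ := L.exists_max_image (fun z => along u v z / cross v u z) hLe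
        have ha' := Finset.mem_filter.1 ha
        have hua : a ≠ u := by
          rintro rfl
          simp at ha'
        refine ⟨a, IsHullEdge.of_nonneg hg ha'.1 hu hua ?_⟩
        intro c hc hca hcu
        by_cases hcv : c = v
        · subst hcv
          have : cross a u c = -cross c u a := by
            simp only [cross]
            ring
          linarith
        rw [cross_swap]
        rcases hside c hc hcu hcv with h | h
        · have h1 := hmax c h
          have h2 := (Finset.mem_filter.1 h).2
          rw [← neg_div_neg_eq, ← neg_div_neg_eq (along u v a),
            div_le_div_iff₀ (by linarith) (by linarith)] at h1
          have h3 := along_mul_cross_sub u v a c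
          rw [cross_swap v u a, cross_swap v u c] at h3
          nlinarith
        · have := hcase a ha c h
          linarith

theorem IsHullEdge.exists_right {X : Finset Pt} {a b : Pt} (hg : CrossGen X)
    (h : IsHullEdge X a b) : ∃ c, IsHullEdge X b c := by
  rcases exists_isHullEdge_beyond hg h.2.1 h.1 h.2.2.1.symm with ⟨x, y, hxy, h1, -⟩ | h'
  · exfalso
    by_cases hxa : x = a
    · subst hxa; simp at h1
    by_cases hxb : x = b
    · subst hxb; simp at h1
    exact absurd (h.2.2.2 x hxy.1 hxa hxb) h1.le.not_gt
  · exact h'.1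

theorem IsHullEdge.exists_left {X : Finset Pt} {a b : Pt} (hg : CrossGen X)
    (h : IsHullEdge X a b) : ∃ c, IsHullEdge X c a := by
  rcases exists_isHullEdge_beyond hg h.1 h.2.1 h.2.2.1 with ⟨x, y, hxy, -, h1⟩ | h'
  · exfalso
    rw [cross_swap] at h1
    by_cases hya : y = a
    · subst hya; simp at h1
    by_cases hyb : y = b
    · subst hyb; simp at h1
    have := h.2.2.2 y hxy.2.1 hya hyb
    linarith
  · exact h'.2

/-- A set of hull edges is no larger than the set of extreme points. -/
theorem card_le_ncard_extremePoints {X : Finset Pt} (D : Finset (Pt × Pt))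
    (hD : ∀ d ∈ D, IsHullEdge X d.1 d.2) :
    D.card ≤ ((X : Set Pt) ∩ Set.extremePoints ℝ (convexHull ℝ (X : Set Pt))).ncard := by
  have hinj : Set.InjOn (fun d : Pt × Pt => d.1) D := by
    intro d hd d' hd' h
    have h1 := hD d hd
    have h2 := hD d' hd'
    simp only at h
    rw [← h] at h2
    exact Prod.ext h (h1.right_unique h2)
  rw [← Finset.card_image_of_injOn hinj, ← Set.ncard_coe_finset]
  apply Set.ncard_le_ncard _ (X.finite_toSet.subset Set.inter_subset_left)
  intro z hz
  obtain ⟨d, hd, rfl⟩ := Finset.mem_image.1 (Finset.mem_coe.1 hz)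
  exact ⟨(hD d hd).1, (hD d hd).mem_extremePoints⟩

theorem exists_component_labelling {α : Type*} [DecidableEq α] (T : Finset α)
    (H : Finset (Sym2 α)) :
    ∃ c : α → α, (∀ a b, s(a, b) ∈ H → c a = c b) ∧ T.card ≤ (T.image c).card + H.card := by
  induction H using Finset.induction_on with
  | empty => exact ⟨id, by simp, by simp⟩
  | insert e H he ih =>
    obtain ⟨c, hc, hT⟩ := ih
    induction e with
    | _ x y =>
      refine ⟨fun z => if c z = c x then c y else c z, ?_, ?_⟩
      · intro a b hab
        rcases Finset.mem_insert.1 hab with h | h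
        · rw [Sym2.eq_iff] at h
          rcases h with ⟨rfl, rfl⟩ | ⟨rfl, rfl⟩ <;> by_cases h : c a = c b <;> simp [h, eq_comm]
        · simp only [hc a b h]
      · have : T.image c ⊆ insert (c x) (T.image fun z => if c z = c x then c y else c z) := by
          intro i hi
          obtain ⟨z, hz, rfl⟩ := Finset.mem_image.1 hi
          by_cases h : c z = c x
          · simp [h]
          · exact Finset.mem_insert_of_mem (Finset.mem_image.2 ⟨z, hz, if_neg h⟩)
        have h1 := Finset.card_le_card this
        have h2 := Finset.card_insert_le (c x) (T.image fun z => if c z = c x then c y else c z)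
        rw [Finset.card_insert_of_notMem he]
        omega

/-- At least `n` positive parts of total `2 * n`, none exceeding `n` and not all equal to two, have
a subfamily of total `n`. -/
theorem exists_subset_sum_eq {ι : Type*} [DecidableEq ι] (S : Finset ι) (m : ι → ℕ) (n : ℕ)
    (h1 : ∀ i ∈ S, 1 ≤ m i) (hn : ∀ i ∈ S, m i ≤ n) (hsum : ∑ i ∈ S, m i = 2 * n)
    (hS : n ≤ S.card) (h2 : ∃ i ∈ S, m i ≠ 2) : ∃ J ⊆ S, ∑ i ∈ J, m i = n := by
  obtain ⟨i₁, hi₁, hi₁2⟩ := h2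
  obtain ⟨i₀, hi₀, hmax⟩ := S.exists_max_image m ⟨i₁, hi₁⟩
  obtain ⟨J, hJ, hJmax⟩ := (S.powerset.filter fun J => i₀ ∈ J ∧ ∑ i ∈ J, m i ≤ n).exists_max_image
    (fun J => ∑ i ∈ J, m i) ⟨{i₀}, by simp [hi₀, hn i₀ hi₀]⟩
  simp only [Finset.mem_filter, Finset.mem_powerset] at hJ hJmax
  obtain ⟨hJS, hi₀J, hJn⟩ := hJ
  rcases hJn.eq_or_lt with hJn | hJn
  · exact ⟨J, hJS, hJn⟩
  have hbig : ∀ j ∈ S, j ∉ J → n < ∑ i ∈ J, m i + m j := by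
    intro j hj hjJ
    by_contra! hle
    have h := hJmax (insert j J) ⟨Finset.insert_subset hj hJS, by simp [hi₀J], by
      rw [Finset.sum_insert hjJ]; omega⟩
    rw [Finset.sum_insert hjJ] at h
    have := h1 j hj
    omega
  obtain ⟨j, hj, hjJ⟩ : ∃ j ∈ S, j ∉ J := by
    by_contra! hall
    obtain rfl : J = S := hJS.antisymm hall
    omega
  have hji₀ : i₀ ≠ j := by
    rintro rfl
    exact hjJ hi₀J
  have hjb := hbig j hj hjJ
  have hjm := hmax j hj
  set U := S.filter fun i => m i = 1 with hU
  have hUJ : U ⊆ J := by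
    intro i hi
    rw [hU, Finset.mem_filter] at hi
    by_contra hiJ
    have := hbig i hi.1 hiJ
    omega
  have hones : m i₀ + m j ≤ U.card + 4 := by
    have e1 : ∑ i ∈ S, ((m i : ℤ) - 2) ≤ 0 := by
      rw [Finset.sum_sub_distrib, ← Nat.cast_sum, hsum]
      simp only [Finset.sum_const, nsmul_eq_mul]
      push_cast
      linarith [(Nat.cast_le (α := ℤ)).2 hS]
    rw [← Finset.sum_filter_add_sum_filter_not S (fun i => m i = 1)] at e1
    have e2 : ∑ i ∈ S.filter (fun i => m i = 1), ((m i : ℤ) - 2) = -U.card := by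
      rw [Finset.sum_congr rfl (g := fun _ => (-1 : ℤ))]
      · simp [hU]
      · intro i hi
        rw [(Finset.mem_filter.1 hi).2]
        rfl
    have e3 : ∑ i ∈ {i₀, j}, ((m i : ℤ) - 2) ≤
        ∑ i ∈ S.filter (fun i => ¬ m i = 1), ((m i : ℤ) - 2) := by
      apply Finset.sum_le_sum_of_subset_of_nonneg
      · intro i hi
        simp only [Finset.mem_insert, Finset.mem_singleton] at hi
        rw [Finset.mem_filter]
        rcases hi with rfl | rfl
        · exact ⟨hi₀, by omega⟩
        · exact ⟨hj, by omega⟩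
      · intro i hi _
        rw [Finset.mem_filter] at hi
        have := h1 i hi.1
        omega
    rw [Finset.sum_pair hji₀] at e3
    omega
  have hr : ∑ i ∈ J, m i + m j - n ≤ U.card := by
    rcases Nat.lt_or_ge (m i₀) 3 with h | h
    · have h3 := hmax i₁ hi₁
      have h4 := h1 i₁ hi₁
      have : 0 < U.card := Finset.card_pos.2 ⟨i₁, Finset.mem_filter.2 ⟨hi₁, by omega⟩⟩
      omega
    · omega
  obtain ⟨R, hRU, hR⟩ := Finset.exists_subset_card_eq hr
  have hRsum : ∑ i ∈ R, m i = R.card := by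
    rw [Finset.card_eq_sum_ones]
    apply Finset.sum_congr rfl
    intro i hi
    exact (Finset.mem_filter.1 (hRU hi)).2
  refine ⟨insert j (J \ R), ?_, ?_⟩
  · exact Finset.insert_subset hj (Finset.sdiff_subset.trans hJS)
  · rw [Finset.sum_insert (by simp [hjJ])]
    have := Finset.sum_sdiff (f := m) (hRU.trans hUJ)
    omega

theorem Avoidable.of_labelling {Y : Finset Pt} {H : Finset (Sym2 Pt)} (hg : CrossGen Y)
    (c : Pt → Pt) (hc : ∀ a b, s(a, b) ∈ H → c a = c b) (k : ℕ) (hY : Y.card = 2 * k)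
    (hk : k ≤ (Y.image c).card) (hle : ∀ i ∈ Y.image c, (Y.filter fun z => c z = i).card ≤ k)
    (h2 : ∃ i ∈ Y.image c, (Y.filter fun z => c z = i).card ≠ 2) : Avoidable Y H := by
  obtain ⟨J, hJ, hJs⟩ := exists_subset_sum_eq (Y.image c)
    (fun i => (Y.filter fun z => c z = i).card) k
    (fun i hi => by
      obtain ⟨z, hz, rfl⟩ := Finset.mem_image.1 hi
      exact Finset.card_pos.2 ⟨z, Finset.mem_filter.2 ⟨hz, rfl⟩⟩)
    hle (by rw [← hY, Finset.card_eq_sum_card_image c]) hk h2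
  apply Avoidable.of_coloring hg (fun z => c z ∈ J)
  · rw [hY, ← hJs, Finset.card_eq_sum_card_fiberwise (s := Y.filter fun z => c z ∈ J) (t := J)
      (f := c) (fun z hz => (Finset.mem_filter.1 hz).2)]
    congr 1
    apply Finset.sum_congr rfl
    intro i hi
    congr 1
    ext z
    simp only [Finset.mem_filter]
    constructor
    · tauto
    · rintro ⟨h1, rfl⟩
      exact ⟨⟨h1, hi⟩, rfl⟩
  · intro a _ b _ ha hb hab
    rw [hc a b hab] at ha
    exact hb ha

theorem Avoidable.of_many_labels {Y : Finset Pt} {H : Finset (Sym2 Pt)} (hg : CrossGen Y)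
    (c : Pt → Pt) (hc : ∀ a b, s(a, b) ∈ H → c a = c b) (k : ℕ) (hY : Y.card = 2 * k)
    (hk : k + 1 ≤ (Y.image c).card) : Avoidable Y H := by
  have hsum := Finset.card_eq_sum_card_image c Y
  have hpos : ∀ i ∈ Y.image c, 1 ≤ (Y.filter fun z => c z = i).card := by
    intro i hi
    obtain ⟨z, hz, rfl⟩ := Finset.mem_image.1 hi
    exact Finset.card_pos.2 ⟨z, Finset.mem_filter.2 ⟨hz, rfl⟩⟩
  apply Avoidable.of_labelling hg c hc k hY (by omega)
  · intro i hi
    have h1 := Finset.add_sum_erase (Y.image c) (fun i => (Y.filter fun z => c z = i).card) hi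
    have h2 := Finset.card_nsmul_le_sum ((Y.image c).erase i)
      (fun i => (Y.filter fun z => c z = i).card) 1 fun j hj => hpos j (Finset.mem_of_mem_erase hj)
    rw [Finset.card_erase_of_mem hi, smul_eq_mul, mul_one] at h2
    omega
  · by_contra! h
    rw [Finset.sum_congr rfl h, Finset.sum_const, smul_eq_mul] at hsum
    omega

theorem exists_two_isHullEdge {X : Finset Pt} (hg : CrossGen X) (hX : 3 ≤ X.card) :
    ∃ a u b, IsHullEdge X a u ∧ IsHullEdge X u b ∧ a ≠ b := by
  obtain ⟨u, hu, v, hv, huv⟩ := Finset.one_lt_card.1 (show 1 < X.card by omega)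
  obtain ⟨x, y, hxy⟩ : ∃ x y, IsHullEdge X x y := by
    rcases exists_isHullEdge_beyond hg hu hv huv with ⟨a, b, h, -⟩ | ⟨⟨b, h⟩, -⟩
    exacts [⟨a, b, h⟩, ⟨u, b, h⟩]
  obtain ⟨z, hz⟩ := hxy.exists_right hg
  refine ⟨x, y, z, hxy, hz, ?_⟩
  rintro rfl
  have := Finset.card_le_card (hxy.subset_of_symm hz)
  have := Finset.card_le_two (a := x) (b := y)
  omega

/-- If `n` edges eliminate all non-crossing perfect matchings of `2 * n` points, then they touch
at most `n + 1` of the points. -/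
theorem exists_support_of_not_avoidable {X : Finset Pt} {H : Finset (Sym2 Pt)} {n : ℕ} (hn : 2 ≤ n)
    (hg : CrossGen X) (hX : X.card = 2 * n) (hE : ∀ e ∈ H, IsEdgeOf X e) (hH : H.card = n)
    (hbl : ¬ Avoidable X H) :
    ∃ T ⊆ X, T.card = n + 1 ∧ ∀ a b, s(a, b) ∈ H → a ∈ T := by
  obtain ⟨c, hc, hcard⟩ := exists_component_labelling X H
  have hk : n ≤ (X.image c).card := by omega
  by_cases hle : ∀ i ∈ X.image c, (X.filter fun z => c z = i).card ≤ n
  · exfalso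
    have h2 : ∀ i ∈ X.image c, (X.filter fun z => c z = i).card = 2 := by
      by_contra! h
      exact hbl (Avoidable.of_labelling hg c hc n hX hk hle h)
    obtain ⟨p, q, hpq, hcpq⟩ : ∃ p q, IsHullEdge X p q ∧ c p ≠ c q := by
      obtain ⟨a, u, b, hau, hub, hab⟩ := exists_two_isHullEdge hg (by omega)
      by_contra! h
      have h3 := h2 (c u) (Finset.mem_image_of_mem c hau.2.1)
      have h4 : ({a, u, b} : Finset Pt) ⊆ X.filter fun z => c z = c u := by
        intro z hz
        simp only [Finset.mem_insert, Finset.mem_singleton] at hz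
        rw [Finset.mem_filter]
        rcases hz with rfl | rfl | rfl
        exacts [⟨hau.1, h _ _ hau⟩, ⟨hau.2.1, rfl⟩, ⟨hub.2.1, (h _ _ hub).symm⟩]
      have h5 := Finset.card_le_card h4
      rw [Finset.card_eq_three.2 ⟨a, u, b, hau.2.2.1, hab, hub.2.2.1, rfl⟩] at h5
      omega
    apply hbl
    apply Avoidable.of_isHullEdge hpq (fun h => hcpq (hc p q h))
    have hsub : ({p, q} : Finset Pt) ⊆ X := by
      simp [Finset.insert_subset_iff, hpq.1, hpq.2.1]
    apply Avoidable.of_many_labels (hg.mono Finset.sdiff_subset) c hc (n - 1)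
    · rw [Finset.card_sdiff_of_subset hsub, Finset.card_pair hpq.2.2.1]
      omega
    · have : X.image c ⊆ (X \ {p, q}).image c := by
        intro i hi
        have h3 := h2 i hi
        obtain ⟨x, y, hxy, hF⟩ := Finset.card_eq_two.1 h3
        have hx : x ∈ X.filter fun z => c z = i := by simp [hF]
        have hy : y ∈ X.filter fun z => c z = i := by simp [hF]
        rw [Finset.mem_filter] at hx hy
        by_cases hx' : x ∈ ({p, q} : Finset Pt)
        · refine Finset.mem_image.2 ⟨y, Finset.mem_sdiff.2 ⟨hy.1, ?_⟩, hy.2⟩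
          intro hy'
          simp only [Finset.mem_insert, Finset.mem_singleton] at hx' hy'
          rcases hx' with rfl | rfl <;> rcases hy' with rfl | rfl
          · exact hxy rfl
          · exact hcpq (hx.2.trans hy.2.symm)
          · exact hcpq (hy.2.trans hx.2.symm)
          · exact hxy rfl
        · exact Finset.mem_image.2 ⟨x, Finset.mem_sdiff.2 ⟨hx.1, hx'⟩, hx.2⟩
      have := Finset.card_le_card this
      omega
  · push Not at hle
    obtain ⟨i, hi, hin⟩ := hle
    have e1 := Finset.card_filter_add_card_filter_not (s := X) (fun z => c z = i)
    have e2 : (X.image c).erase i ⊆ (X.filter fun z => ¬ c z = i).image c := by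
      intro j hj
      rw [Finset.mem_erase] at hj
      obtain ⟨z, hz, rfl⟩ := Finset.mem_image.1 hj.2
      exact Finset.mem_image_of_mem c (Finset.mem_filter.2 ⟨hz, hj.1⟩)
    have e3 := Finset.card_le_card e2
    rw [Finset.card_erase_of_mem hi] at e3
    have e4 : ((X.filter fun z => ¬ c z = i).image c).card ≤ (X.filter fun z => ¬ c z = i).card :=
      Finset.card_image_le
    have hinj : Set.InjOn c (X.filter fun z => ¬ c z = i) := Finset.card_image_iff.1 (by omega)
    refine ⟨X.filter fun z => c z = i, Finset.filter_subset _ _, by omega, ?_⟩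
    intro a b hab
    have ha := (hE _ hab).2 a (by simp)
    have hb := (hE _ hab).2 b (by simp)
    by_contra hai
    have hca : ¬ c a = i := fun h => hai (Finset.mem_filter.2 ⟨ha, h⟩)
    have hcab := hc a b hab
    apply (hE _ hab).1
    rw [Sym2.mk_isDiag_iff]
    exact hinj (by simp [ha, hca]) (by simp [hb, ← hcab, hca]) hcab

/-- The configuration to be excluded: `n ≥ 2` edges on `n + 1` out of `2 * n` points in general
position that eliminate all non-crossing perfect matchings. -/
structure BlockingTree (n : ℕ) (X T : Finset Pt) (H : Finset (Sym2 Pt)) : Prop where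
  two_le : 2 ≤ n
  crossGen : CrossGen X
  card_X : X.card = 2 * n
  subset : T ⊆ X
  card_T : T.card = n + 1
  mem_left : ∀ {a b}, s(a, b) ∈ H → a ∈ T
  ne : ∀ {a b}, s(a, b) ∈ H → a ≠ b
  card_H : H.card = n
  not_avoidable : ¬ Avoidable X H

/-- `u` is a leaf of `H` with neighbour `v`. -/
def IsLeaf (H : Finset (Sym2 Pt)) (u v : Pt) : Prop :=
  s(u, v) ∈ H ∧ ∀ b, s(u, b) ∈ H → b = v

namespace BlockingTree

variable {n : ℕ} {X T : Finset Pt} {H : Finset (Sym2 Pt)}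

theorem mem_right (h : BlockingTree n X T H) {a b : Pt} (hab : s(a, b) ∈ H) : b ∈ T :=
  h.mem_left (Sym2.eq_swap ▸ hab)

theorem card_sdiff (h : BlockingTree n X T H) : (X \ T).card = n - 1 := by
  rw [Finset.card_sdiff_of_subset h.subset, h.card_X, h.card_T]
  omega

theorem notMem_of_edge (h : BlockingTree n X T H) (a b : Pt) (hab : s(a, b) ∈ H) : a ∉ X \ T :=
  fun h' => (Finset.mem_sdiff.1 h').2 (h.mem_left hab)

theorem eq_of_closed (h : BlockingTree n X T H) {S : Finset Pt} (hS : S ⊆ T) (hne : S.Nonempty)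
    (hcl : ∀ a ∈ S, ∀ b, s(a, b) ∈ H → b ∈ S) : S = T := by
  by_contra hST
  have h1 : S.card < T.card := Finset.card_lt_card (hS.ssubset_of_ne hST)
  have h2 := hne.card_pos
  have hT := h.card_T
  apply h.not_avoidable
  apply Avoidable.of_fill h.crossGen h.notMem_of_edge (fun z => z ∈ S) n h.card_X
  · calc _ ≤ S.card := Finset.card_le_card fun z hz => (Finset.mem_filter.1 hz).2.2
      _ ≤ n := by omega
  · calc _ ≤ (T \ S).card := Finset.card_le_card fun z hz => by
          simp only [Finset.mem_filter, Finset.mem_sdiff] at hz ⊢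
          tauto
      _ ≤ n := by rw [Finset.card_sdiff_of_subset hS]; omega
  · exact fun a _ b _ ha hb hab => hb (hcl a ha b hab)

/-- Removing an edge of `H` disconnects its endpoints. -/
theorem exists_split (h : BlockingTree n X T H) {x y : Pt} (hxy : s(x, y) ∈ H) :
    ∃ S ⊆ T, x ∈ S ∧ y ∉ S ∧ ∀ a b, s(a, b) ∈ H → a ∈ S → b ∉ S → a = x ∧ b = y := by
  obtain ⟨c, hc, hcard⟩ := exists_component_labelling T (H.erase s(x, y))
  rw [h.card_T, Finset.card_erase_of_mem hxy, h.card_H] at hcard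
  have hn := h.two_le
  have hne : c x ≠ c y := by
    intro hcxy
    have hall : ∀ a b, s(a, b) ∈ H → c a = c b := by
      intro a b hab
      by_cases h' : s(a, b) = s(x, y)
      · rcases Sym2.eq_iff.1 h' with ⟨rfl, rfl⟩ | ⟨rfl, rfl⟩
        exacts [hcxy, hcxy.symm]
      · exact hc a b (Finset.mem_erase.2 ⟨h', hab⟩)
    have hT := h.eq_of_closed (S := T.filter fun z => c z = c x) (Finset.filter_subset _ _)
      ⟨x, Finset.mem_filter.2 ⟨h.mem_left hxy, rfl⟩⟩ (by
        intro a ha b hab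
        rw [Finset.mem_filter] at ha ⊢
        exact ⟨h.mem_right hab, (hall a b hab).symm.trans ha.2⟩)
    have : T.image c ⊆ {c x} := by
      intro i hi
      obtain ⟨z, hz, rfl⟩ := Finset.mem_image.1 hi
      rw [← hT, Finset.mem_filter] at hz
      simp [hz.2]
    have := Finset.card_le_card this
    rw [Finset.card_singleton] at this
    omega
  refine ⟨T.filter fun z => c z = c x, Finset.filter_subset _ _,
    Finset.mem_filter.2 ⟨h.mem_left hxy, rfl⟩, fun hy => hne (Finset.mem_filter.1 hy).2.symm, ?_⟩
  intro a b hab ha hb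
  have hca := (Finset.mem_filter.1 ha).2
  have hcb : c b ≠ c x := fun hcb => hb (Finset.mem_filter.2 ⟨h.mem_right hab, hcb⟩)
  by_cases h' : s(a, b) = s(x, y)
  · rcases Sym2.eq_iff.1 h' with h' | ⟨rfl, rfl⟩
    · exact h'
    · exact absurd rfl hcb
  · exact absurd ((hc a b (Finset.mem_erase.2 ⟨h', hab⟩)).symm.trans hca) hcb

theorem card_filter (h : BlockingTree n X T H) (P : Pt → Prop) [DecidablePred P] :
    (X.filter P).card = (T.filter P).card + ((X \ T).filter P).card := by
  rw [← Finset.card_union_of_disjoint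
    (Finset.disjoint_filter_filter (Finset.disjoint_sdiff (s := T) (t := X))),
    ← Finset.filter_union, Finset.union_sdiff_of_subset h.subset]

theorem avoidable_of_fill (h : BlockingTree n X T H) {Y : Finset Pt} (hYX : Y ⊆ X)
    (c : Pt → Prop) [DecidablePred c] (m : ℕ) (hY : Y.card = 2 * m)
    (h₁ : (Y.filter fun z => z ∈ T ∧ c z).card ≤ m)
    (h₂ : (Y.filter fun z => z ∈ T ∧ ¬ c z).card ≤ m)
    (hH : ∀ a ∈ Y, ∀ b ∈ Y, c a → ¬ c b → s(a, b) ∉ H) : Avoidable Y H := by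
  apply Avoidable.of_fill (h.crossGen.mono hYX) h.notMem_of_edge c m hY _ _ hH
  · convert h₁ using 2
    ext z
    simp only [Finset.mem_filter, Finset.mem_sdiff]
    have := @hYX z
    tauto
  · convert h₂ using 2
    ext z
    simp only [Finset.mem_filter, Finset.mem_sdiff]
    have := @hYX z
    tauto

theorem avoidable_of_few (h : BlockingTree n X T H) {Y : Finset Pt} (hYX : Y ⊆ X) (m : ℕ)
    (hY : Y.card = 2 * m) (h₁ : (Y.filter fun z => z ∈ T).card ≤ m) : Avoidable Y H := by
  apply h.avoidable_of_fill hYX (fun _ => True) m hY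
  · simpa using h₁
  · simp
  · simp

theorem card_side_T (h : BlockingTree n X T H) {u v : Pt} (hu : u ∈ T) (hv : v ∈ T) (huv : u ≠ v) :
    (T.filter fun z => 0 < cross u v z).card + (T.filter fun z => cross u v z < 0).card + 1 =
      n := by
  have e1 := Finset.card_filter_add_card_filter_not (s := T) (fun z => 0 < cross u v z)
  have e2 := Finset.card_filter_add_card_filter_not (s := T.filter fun z => ¬ 0 < cross u v z)
    (fun z => cross u v z < 0)
  rw [Finset.filter_filter, Finset.filter_filter] at e2
  have e3 : (T.filter fun z => ¬ 0 < cross u v z ∧ ¬ cross u v z < 0) = {u, v} := by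
    ext z
    simp only [Finset.mem_filter, Finset.mem_insert, Finset.mem_singleton]
    constructor
    · rintro ⟨hz, h1, h2⟩
      by_contra! hzz
      exact h.crossGen u (h.subset hu) v (h.subset hv) z (h.subset hz) huv hzz.1.symm hzz.2.symm
        (le_antisymm (not_lt.1 h1) (not_lt.1 h2))
    · rintro (rfl | rfl) <;> simp [*]
  have e4 : (T.filter fun z => ¬ 0 < cross u v z ∧ cross u v z < 0) =
      T.filter fun z => cross u v z < 0 := by
    apply Finset.filter_congr
    intro z _
    exact ⟨fun h => h.2, fun h => ⟨h.le.not_gt, h⟩⟩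
  rw [e3, e4, Finset.card_pair huv] at e2
  have := h.card_T
  omega

theorem card_side_sdiff (h : BlockingTree n X T H) {u v : Pt} (hu : u ∈ T) (hv : v ∈ T)
    (huv : u ≠ v) : ((X \ T).filter fun z => 0 < cross u v z).card +
      ((X \ T).filter fun z => cross u v z < 0).card + 1 = n := by
  have e1 := Finset.card_filter_add_card_filter_not (s := X \ T) (fun z => 0 < cross u v z)
  have e4 : ((X \ T).filter fun z => ¬ 0 < cross u v z) =
      (X \ T).filter fun z => cross u v z < 0 := by
    apply Finset.filter_congr
    intro z hz
    rw [Finset.mem_sdiff] at hz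
    have := h.crossGen u (h.subset hu) v (h.subset hv) z hz.1 huv
      (fun h' => hz.2 (h' ▸ hu)) (fun h' => hz.2 (h' ▸ hv))
    exact ⟨fun h => (not_lt.1 h).lt_of_ne this, fun h => h.le.not_gt⟩
  rw [e4, h.card_sdiff] at e1
  have := h.two_le
  omega

/-- The line through `u` and `v` has as many points of `T` as of `X \ T` on each side. -/
def Balanced (X T : Finset Pt) (u v : Pt) : Prop :=
  (T.filter fun z => 0 < cross u v z).card = ((X \ T).filter fun z => 0 < cross u v z).card ∧
  (T.filter fun z => cross u v z < 0).card = ((X \ T).filter fun z => cross u v z < 0).card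

theorem Balanced.symm {u v : Pt} (hb : Balanced X T u v) : Balanced X T v u := by
  simp only [Balanced, cross_swap u v, neg_pos, neg_lt_zero]
  exact ⟨hb.2, hb.1⟩

theorem balanced_of_isLeaf (h : BlockingTree n X T H) {u v : Pt} (hl : IsLeaf H u v) :
    Balanced X T u v := by
  have hu := h.mem_left hl.1
  have hv := h.mem_right hl.1
  have huv := h.ne hl.1
  have key : (X.filter fun z => 0 < cross u v z ∧ z ∈ T.erase u).card =
      (X.filter fun z => 0 < cross u v z ∧ ¬ z ∈ T.erase u).card := by
    by_contra hne
    apply h.not_avoidable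
    apply Avoidable.of_unbalanced h.crossGen (fun z => z ∈ T.erase u) _ (h.subset hu)
      (h.subset hv) (by simp) (by simp [hv, huv.symm]) _ hne
    · rw [Finset.filter_mem_eq_inter,
        Finset.inter_eq_right.2 ((Finset.erase_subset _ _).trans h.subset),
        Finset.card_erase_of_mem hu, h.card_T, h.card_X]
      rfl
    · intro a _ b _ ha hb hab
      have hbT := h.mem_right hab
      have : b = u := by
        by_contra hbu
        exact hb (Finset.mem_erase.2 ⟨hbu, hbT⟩)
      subst this
      exact ⟨hl.2 a (Sym2.eq_swap ▸ hab), rfl⟩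
  have e1 : (X.filter fun z => 0 < cross u v z ∧ z ∈ T.erase u) =
      T.filter fun z => 0 < cross u v z := by
    ext z
    simp only [Finset.mem_filter, Finset.mem_erase]
    constructor
    · tauto
    · rintro ⟨hz, hz'⟩
      refine ⟨h.subset hz, hz', ?_, hz⟩
      rintro rfl
      simp at hz'
  have e2 : (X.filter fun z => 0 < cross u v z ∧ ¬ z ∈ T.erase u) =
      (X \ T).filter fun z => 0 < cross u v z := by
    ext z
    simp only [Finset.mem_filter, Finset.mem_erase, Finset.mem_sdiff]
    constructor
    · rintro ⟨hz, hz', h3⟩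
      refine ⟨⟨hz, fun h4 => h3 ⟨?_, h4⟩⟩, hz'⟩
      rintro rfl
      simp at hz'
    · tauto
  rw [e1, e2] at key
  have := h.card_side_T hu hv huv
  have := h.card_side_sdiff hu hv huv
  exact ⟨key, by omega⟩

theorem not_crosses_of_split (h : BlockingTree n X T H) {u v s t : Pt} (hu : u ∈ T) (hv : v ∈ T)
    (huv : u ≠ v) (hb : Balanced X T u v) (c : Pt → Prop) [DecidablePred c]
    (hcs : c s) (hsT : s ∈ T) (hcu : ¬ c u) (hcv : ¬ c v)
    (hc : ∀ a b, s(a, b) ∈ H → c a → ¬ c b → a = s ∧ b = t)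
    (hs : 0 < cross u v s) (ht : cross u v t < 0) : False := by
  have htot := h.card_side_sdiff hu hv huv
  have htotT := h.card_side_T hu hv huv
  have hX := h.card_X
  have hn := h.two_le
  have hd : ∀ a b, cross a b = fun z => -cross b a z := fun a b => funext fun z => cross_swap b a z
  have hneg := h.card_filter (fun z => cross u v z < 0)
  have hXs := Finset.card_filter_add_card_filter_not (s := X) (fun z => cross u v z < 0)
  simp only [not_lt] at hXs
  obtain ⟨hb1, hb2⟩ := hb
  apply h.not_avoidable
  apply Avoidable.of_filter (preservesConvexComb_cross v u)
  · have hY : (X.filter fun z => cross v u z ≤ 0) = X.filter fun z => 0 ≤ cross u v z := by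
      simp only [hd v u, neg_nonpos]
    rw [hY]
    have hT2 := Finset.card_filter_add_card_filter_not (s := T.filter fun z => 0 ≤ cross u v z) c
    simp only [Finset.filter_filter] at hT2
    have hT3 := Finset.card_filter_add_card_filter_not (s := T) (fun z => cross u v z < 0)
    simp only [not_lt] at hT3
    have hT := h.card_T
    have k1 : 1 ≤ (T.filter fun z => 0 ≤ cross u v z ∧ c z).card :=
      Finset.card_pos.2 ⟨s, by simp [hsT, hs.le, hcs]⟩
    have k2 : 2 ≤ (T.filter fun z => 0 ≤ cross u v z ∧ ¬ c z).card := by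
      rw [← Finset.card_pair huv]
      apply Finset.card_le_card
      intro z hz
      simp only [Finset.mem_insert, Finset.mem_singleton] at hz
      rcases hz with rfl | rfl <;> simp [hu, hv, hcu, hcv]
    have sub1 : ((X.filter fun z => 0 ≤ cross u v z).filter fun z => z ∈ T ∧ c z).card ≤
        (T.filter fun z => 0 ≤ cross u v z ∧ c z).card := by
      apply Finset.card_le_card
      intro z
      simp only [Finset.mem_filter]
      tauto
    have sub2 : ((X.filter fun z => 0 ≤ cross u v z).filter fun z => z ∈ T ∧ ¬ c z).card ≤
        (T.filter fun z => 0 ≤ cross u v z ∧ ¬ c z).card := by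
      apply Finset.card_le_card
      intro z
      simp only [Finset.mem_filter]
      tauto
    apply h.avoidable_of_fill (Finset.filter_subset _ _) c
      (n - (T.filter fun z => cross u v z < 0).card)
    · omega
    · omega
    · omega
    · intro a ha b hb' hca hcb hab
      obtain ⟨rfl, rfl⟩ := hc a b hab hca hcb
      exact absurd (Finset.mem_filter.1 hb').2 (not_le.2 ht)
  · have hY : (X.filter fun z => 0 < cross v u z) = X.filter fun z => cross u v z < 0 := by
      simp only [hd v u, neg_pos]
    rw [hY]
    have sub1 : ∀ P : Pt → Prop, ∀ _ : DecidablePred P,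
        ((X.filter fun z => cross u v z < 0).filter fun z => z ∈ T ∧ P z).card ≤
        (T.filter fun z => cross u v z < 0).card := by
      intro P _
      apply Finset.card_le_card
      intro z
      simp only [Finset.mem_filter]
      tauto
    apply h.avoidable_of_fill (Finset.filter_subset _ _) c
      (T.filter fun z => cross u v z < 0).card
    · omega
    · exact sub1 _ _
    · exact sub1 _ _
    · intro a ha b hb' hca hcb hab
      obtain ⟨rfl, rfl⟩ := hc a b hab hca hcb
      exact absurd (Finset.mem_filter.1 ha).2 (not_lt.2 hs.le)

/-- No edge of `H` crosses the line through a leaf edge. -/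
theorem not_crosses_leaf_line (h : BlockingTree n X T H) {u v s t : Pt} (hl : IsLeaf H u v)
    (hst : s(s, t) ∈ H) (hs : 0 < cross u v s) (ht : cross u v t < 0) : False := by
  have hu := h.mem_left hl.1
  have hv := h.mem_right hl.1
  have huv := h.ne hl.1
  have hb := h.balanced_of_isLeaf hl
  obtain ⟨S, hST, hsS, htS, hS⟩ := h.exists_split hst
  have hvu : s(v, u) ∈ H := Sym2.eq_swap ▸ hl.1
  by_cases huS : u ∈ S
  · by_cases hvS : v ∈ S
    · apply h.not_crosses_of_split hv hu huv.symm hb.symm (fun z => z ∉ S) htS (h.mem_right hst)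
        (by simpa using hvS) (by simpa using huS) (t := s)
      · intro a b hab ha hb
        have := hS b a (Sym2.eq_swap ▸ hab) (not_not.1 hb) ha
        exact ⟨this.2, this.1⟩
      · rw [cross_swap]
        linarith
      · rw [cross_swap]
        linarith
    · obtain ⟨rfl, -⟩ := hS u v hl.1 huS hvS
      simp at hs
  · by_cases hvS : v ∈ S
    · obtain ⟨rfl, -⟩ := hS v u hvu hvS huS
      simp at hs
    · exact h.not_crosses_of_split hu hv huv hb (fun z => z ∈ S) hsS (h.mem_left hst) huS hvS hS
        hs ht

theorem two_mul_card_side (h : BlockingTree n X T H) {x y : Pt} (hxy : s(x, y) ∈ H)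
    {S J : Finset Pt} (hST : S ⊆ T) (hyS : y ∈ S) (hxS : x ∉ S)
    (hS : ∀ a b, s(a, b) ∈ H → a ∈ S → b ∉ S → a = y ∧ b = x)
    (hJ : J ⊆ X \ T) (hcard : S.card + J.card = n) :
    2 * ((S.filter fun z => 0 < cross x y z).card + (J.filter fun z => 0 < cross x y z).card) =
      (X.filter fun z => 0 < cross x y z).card := by
  have hd : Disjoint S J := Finset.disjoint_left.2 fun z hz hz' =>
    (Finset.mem_sdiff.1 (hJ hz')).2 (hST hz)
  have hSJX : S ∪ J ⊆ X := Finset.union_subset (hST.trans h.subset) (hJ.trans Finset.sdiff_subset)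
  have hxJ : x ∉ S ∪ J := fun hx => by
    rcases Finset.mem_union.1 hx with hx | hx
    exacts [hxS hx, (Finset.mem_sdiff.1 (hJ hx)).2 (h.mem_left hxy)]
  have key : (X.filter fun z => 0 < cross x y z ∧ z ∈ S ∪ J).card =
      (X.filter fun z => 0 < cross x y z ∧ ¬ z ∈ S ∪ J).card := by
    by_contra hne
    apply h.not_avoidable
    apply Avoidable.of_unbalanced h.crossGen (fun z => z ∈ S ∪ J) _ (h.subset (h.mem_left hxy))
      (h.subset (h.mem_right hxy)) hxJ (by simp [hyS]) _ hne
    · rw [Finset.filter_mem_eq_inter, Finset.inter_eq_right.2 hSJX,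
        Finset.card_union_of_disjoint hd, hcard, h.card_X]
    · intro a _ b _ ha hb hab
      rcases Finset.mem_union.1 ha with ha | ha
      · exact hS a b hab ha fun hb' => hb (Finset.mem_union_left _ hb')
      · exact absurd (h.mem_left hab) (Finset.mem_sdiff.1 (hJ ha)).2
  have e1 := Finset.card_filter_add_card_filter_not (s := X.filter fun z => 0 < cross x y z)
    (fun z => z ∈ S ∪ J)
  rw [Finset.filter_filter, Finset.filter_filter] at e1
  have e2 : (X.filter fun z => 0 < cross x y z ∧ z ∈ S ∪ J) =
      (S.filter fun z => 0 < cross x y z) ∪ J.filter fun z => 0 < cross x y z := by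
    rw [← Finset.filter_union]
    ext z
    simp only [Finset.mem_filter]
    constructor
    · tauto
    · exact fun hz => ⟨hSJX hz.1, hz.2, hz.1⟩
  rw [e2, Finset.card_union_of_disjoint (Finset.disjoint_filter_filter hd)] at e1 key
  omega

theorem cross_nonpos_of_sdiff_neg (h : BlockingTree n X T H) {x y : Pt} (hxy : s(x, y) ∈ H)
    {S : Finset Pt} (hST : S ⊆ T) (hyS : y ∈ S) (hxS : x ∉ S)
    (hS : ∀ a b, s(a, b) ∈ H → a ∈ S → b ∉ S → a = y ∧ b = x) (h2 : 2 ≤ S.card)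
    (hneg : ∀ z ∈ X \ T, cross x y z < 0) : ∀ z ∈ X, cross x y z ≤ 0 := by
  have hSc := Finset.card_le_card hST
  have hST' : S.card < T.card := Finset.card_lt_card
    ⟨hST, fun hTS => hxS (hTS (h.mem_left hxy))⟩
  have hT := h.card_T
  have hI := h.card_sdiff
  have hX := h.card_X
  obtain ⟨J, hJ, hJc⟩ := Finset.exists_subset_card_eq (s := X \ T) (n := n - S.card) (by omega)
  have hbal := h.two_mul_card_side hxy hST hyS hxS hS hJ (by omega)
  have hI0 : ∀ K ⊆ X \ T, (K.filter fun z => 0 < cross x y z) = ∅ := by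
    intro K hK
    rw [Finset.filter_eq_empty_iff]
    exact fun z hz => (hneg z (hK hz)).le.not_gt
  rw [hI0 J hJ, Finset.card_empty, add_zero] at hbal
  by_contra! hex
  obtain ⟨z₀, hz₀, hz₀'⟩ := hex
  have hpos : 0 < (X.filter fun z => 0 < cross x y z).card :=
    Finset.card_pos.2 ⟨z₀, Finset.mem_filter.2 ⟨hz₀, hz₀'⟩⟩
  have hXT := h.card_filter (fun z => 0 < cross x y z)
  rw [hI0 _ subset_rfl, Finset.card_empty, add_zero] at hXT
  have hXs := Finset.card_filter_add_card_filter_not (s := X) (fun z => 0 < cross x y z)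
  simp only [not_lt] at hXs
  have hTs := Finset.card_filter_add_card_filter_not (s := T) (fun z => 0 < cross x y z)
  simp only [not_lt] at hTs
  apply h.not_avoidable
  apply Avoidable.of_filter (preservesConvexComb_cross x y)
  · apply h.avoidable_of_few (Finset.filter_subset _ _)
      (n - (S.filter fun z => 0 < cross x y z).card)
    · omega
    · have : ((X.filter fun z => cross x y z ≤ 0).filter fun z => z ∈ T).card ≤
          (T.filter fun z => cross x y z ≤ 0).card := by
        apply Finset.card_le_card
        intro z
        simp only [Finset.mem_filter]
        tauto
      omega
  · apply Avoidable.of_coloring (h.crossGen.mono (Finset.filter_subset _ _)) (fun z => z ∈ S)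
    · rw [← hbal, Finset.filter_filter]
      congr 2
      ext z
      simp only [Finset.mem_filter]
      constructor
      · tauto
      · exact fun hz => ⟨h.subset (hST hz.1), hz.2, hz.1⟩
    · intro a ha b _ haS hbS hab
      obtain ⟨rfl, -⟩ := hS a b hab haS hbS
      simp at ha

/-- An edge of `H` joining two points of degree at least two is an edge of the convex hull. -/
theorem isHullEdge_of_inner_edge (h : BlockingTree n X T H) {x y : Pt} (hxy : s(x, y) ∈ H)
    (hx : ∃ b, b ≠ y ∧ s(x, b) ∈ H) (hy : ∃ b, b ≠ x ∧ s(y, b) ∈ H) :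
    IsHullEdge X x y ∨ IsHullEdge X y x := by
  have hyx : s(y, x) ∈ H := Sym2.eq_swap ▸ hxy
  obtain ⟨S, hST, hyS, hxS, hS⟩ := h.exists_split hyx
  obtain ⟨b, hby, hxb⟩ := hx
  obtain ⟨b', hbx, hyb⟩ := hy
  have hxT := h.mem_left hxy
  have hyT := h.mem_right hxy
  have hne := h.ne hxy
  have h2 : 2 ≤ S.card := by
    rw [← Finset.card_pair (h.ne hyb)]
    apply Finset.card_le_card
    simp only [Finset.insert_subset_iff, hyS, Finset.singleton_subset_iff, true_and]
    by_contra hb'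
    exact hbx (hS y b' hyb hyS hb').2
  have h3 : 2 ≤ (T \ S).card := by
    rw [← Finset.card_pair (h.ne hxb)]
    apply Finset.card_le_card
    simp only [Finset.insert_subset_iff, Finset.singleton_subset_iff, Finset.mem_sdiff, hxT, hxS,
      h.mem_right hxb, not_false_eq_true, true_and]
    intro hb
    exact hby (hS b x (Sym2.eq_swap ▸ hxb) hb hxS).1
  have h4 := Finset.card_sdiff_of_subset hST
  have hT := h.card_T
  have hI := h.card_sdiff
  by_cases hall : ∀ z ∈ X \ T, cross x y z < 0
  · right
    apply IsHullEdge.of_nonneg h.crossGen (h.subset hyT) (h.subset hxT) hne.symm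
    intro c hc _ _
    have := h.cross_nonpos_of_sdiff_neg hxy hST hyS hxS hS h2 hall c hc
    rw [cross_swap]
    linarith
  push Not at hall
  obtain ⟨p, hp, hp0⟩ := hall
  have hpos : ∀ p' ∈ X \ T, 0 ≤ cross x y p' := by
    intro p' hp'
    by_contra! hneg
    have hp1 : 0 < cross x y p := by
      rw [Finset.mem_sdiff] at hp
      exact hp0.lt_of_ne (h.crossGen x (h.subset hxT) y (h.subset hyT) p hp.1 hne
        (fun e => hp.2 (e ▸ hxT)) (fun e => hp.2 (e ▸ hyT))).symm
    have hpp : p ≠ p' := by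
      rintro rfl
      linarith
    obtain ⟨J, hpJ, hJ, hJc⟩ := Finset.exists_subsuperset_card_eq (n := n - S.card)
      (show {p} ⊆ (X \ T).erase p' by simpa [hpp] using hp) (by simp; omega)
      (by rw [Finset.card_erase_of_mem hp']; omega)
    rw [Finset.singleton_subset_iff] at hpJ
    have hp'J : p' ∉ J := fun hm => by simpa using hJ hm
    have hJI : J ⊆ X \ T := hJ.trans (Finset.erase_subset _ _)
    have b1 := h.two_mul_card_side hxy hST hyS hxS hS hJI (by omega)
    have b2 := h.two_mul_card_side hxy hST hyS hxS hS (J := insert p' (J.erase p))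
      (Finset.insert_subset hp' ((Finset.erase_subset _ _).trans hJI)) (by
        rw [Finset.card_insert_of_notMem (fun hm => hp'J (Finset.mem_of_mem_erase hm)),
          Finset.card_erase_of_mem hpJ]
        have := Finset.card_pos.2 ⟨p, hpJ⟩
        omega)
    rw [Finset.filter_insert, if_neg hneg.le.not_gt, Finset.filter_erase,
      Finset.card_erase_of_mem (Finset.mem_filter.2 ⟨hpJ, hp1⟩)] at b2
    have : 0 < (J.filter fun z => 0 < cross x y z).card :=
      Finset.card_pos.2 ⟨p, Finset.mem_filter.2 ⟨hpJ, hp1⟩⟩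
    omega
  left
  apply IsHullEdge.of_nonneg h.crossGen (h.subset hxT) (h.subset hyT) hne
  intro c hc _ _
  have := h.cross_nonpos_of_sdiff_neg hyx (S := T \ S) Finset.sdiff_subset
    (Finset.mem_sdiff.2 ⟨hxT, hxS⟩) (by simp [hyS]) (by
      intro a b hab ha hb
      rw [Finset.mem_sdiff] at ha hb
      have hb' : b ∈ S := by
        by_contra hbS
        exact hb ⟨h.mem_right hab, hbS⟩
      have := hS b a (Sym2.eq_swap ▸ hab) hb' ha.2
      exact ⟨this.2, this.1⟩) h3 (by
      intro z hz
      have h5 := hpos z hz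
      rw [Finset.mem_sdiff] at hz
      rw [cross_swap]
      have := h.crossGen x (h.subset hxT) y (h.subset hyT) z hz.1 hne
        (fun e => hz.2 (e ▸ hxT)) (fun e => hz.2 (e ▸ hyT))
      have := h5.lt_of_ne this.symm
      linarith) c hc
  rw [cross_swap] at this
  linarith

/-- Removing the pair `{p, q}` keeps the remaining points blocked, unless the pair is in `H`. -/
def IsRemovable (X : Finset Pt) (H : Finset (Sym2 Pt)) (p q : Pt) : Prop :=
  p ∈ X ∧ q ∈ X ∧ p ≠ q ∧ (s(p, q) ∉ H → ¬ Avoidable (X \ {p, q}) H)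

theorem IsRemovable.symm {p q : Pt} (hpq : IsRemovable X H p q) : IsRemovable X H q p :=
  ⟨hpq.2.1, hpq.1, hpq.2.2.1.symm, fun h => by
    rw [Finset.pair_comm]
    exact hpq.2.2.2 (Sym2.eq_swap ▸ h)⟩

theorem isRemovable_of_isHullEdge (h : BlockingTree n X T H) {p q : Pt} (hpq : IsHullEdge X p q) :
    IsRemovable X H p q :=
  ⟨hpq.1, hpq.2.1, hpq.2.2.1, fun hH hA => h.not_avoidable (hA.of_isHullEdge hpq hH)⟩

theorem card_sdiff_pair (h : BlockingTree n X T H) {p q : Pt} (hpq : IsRemovable X H p q) :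
    (X \ {p, q}).card = 2 * (n - 1) := by
  rw [Finset.card_sdiff_of_subset (by simp [Finset.insert_subset_iff, hpq.1, hpq.2.1]), h.card_X,
    Finset.card_pair hpq.2.2.1]
  omega

theorem mem_of_isRemovable (h : BlockingTree n X T H) {p q : Pt} (hpq : IsRemovable X H p q)
    (hp : p ∈ T) (hq : q ∈ T) : s(p, q) ∈ H := by
  by_contra hH
  apply hpq.2.2.2 hH
  apply h.avoidable_of_few Finset.sdiff_subset (n - 1) (h.card_sdiff_pair hpq)
  calc _ ≤ (T \ {p, q}).card := Finset.card_le_card fun z => by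
        simp only [Finset.mem_filter, Finset.mem_sdiff]
        tauto
    _ ≤ n - 1 := by
      rw [Finset.card_sdiff_of_subset (by simp [Finset.insert_subset_iff, hp, hq]), h.card_T,
        Finset.card_pair hpq.2.2.1]
      omega

theorem mem_of_isRemovable_of_inner (h : BlockingTree n X T H) {p q y y' : Pt}
    (hpq : IsRemovable X H p q) (hy : s(q, y) ∈ H) (hy' : s(q, y') ∈ H) (hne : y ≠ y') :
    p ∈ T := by
  by_contra hp
  have hH : s(p, q) ∉ H := fun hH => hp (h.mem_left hH)
  obtain ⟨S, hST, hqS, hyS, hS⟩ := h.exists_split hy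
  have hy'S : y' ∈ S := by
    by_contra hy'S
    exact hne (hS q y' hy' hqS hy'S).2.symm
  have h2 : ({q, y'} : Finset Pt) ⊆ S := by simp [Finset.insert_subset_iff, hqS, hy'S]
  have h2' := Finset.card_le_card h2
  rw [Finset.card_pair (h.ne hy')] at h2'
  have hSc : S.card < T.card := Finset.card_lt_card
    ⟨hST, fun hTS => hyS (hTS (h.mem_right hy))⟩
  have hT := h.card_T
  apply hpq.2.2.2 hH
  apply h.avoidable_of_fill Finset.sdiff_subset (fun z => z ∈ S) (n - 1) (h.card_sdiff_pair hpq)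
  · calc _ ≤ (S.erase q).card := Finset.card_le_card fun z => by
          simp only [Finset.mem_filter, Finset.mem_sdiff, Finset.mem_insert, Finset.mem_singleton,
            Finset.mem_erase]
          tauto
      _ ≤ n - 1 := by rw [Finset.card_erase_of_mem hqS]; omega
  · calc _ ≤ (T \ S).card := Finset.card_le_card fun z => by
          simp only [Finset.mem_filter, Finset.mem_sdiff]
          tauto
      _ ≤ n - 1 := by rw [Finset.card_sdiff_of_subset hST]; omega
  · intro a ha b _ haS hbS hab
    obtain ⟨rfl, -⟩ := hS a b hab haS hbS
    simp at ha

theorem exists_neighbour (h : BlockingTree n X T H) {x : Pt} (hx : x ∈ T) : ∃ y, s(x, y) ∈ H := by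
  by_contra! hno
  have hT := h.eq_of_closed (S := {x}) (by simpa using hx) (by simp) (by
    intro a ha b hab
    rw [Finset.mem_singleton] at ha
    subst ha
    exact absurd hab (hno b))
  have := h.card_T
  have := h.two_le
  rw [← hT, Finset.card_singleton] at *
  omega

theorem isLeaf_or_inner (h : BlockingTree n X T H) {x : Pt} (hx : x ∈ T) :
    (∃ v, IsLeaf H x v) ∨ ∃ y y', s(x, y) ∈ H ∧ s(x, y') ∈ H ∧ y ≠ y' := by
  obtain ⟨y, hy⟩ := h.exists_neighbour hx
  by_cases hl : ∀ b, s(x, b) ∈ H → b = y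
  · exact Or.inl ⟨y, hy, hl⟩
  · push Not at hl
    obtain ⟨b, hb, hby⟩ := hl
    exact Or.inr ⟨b, y, hb, hy, hby⟩

theorem avoidable_of_star (h : BlockingTree n X T H) {x : Pt}
    (hstar : ∀ a b, s(a, b) ∈ H → a = x ∨ b = x) {Y : Finset Pt} (hYX : Y ⊆ X) (hx : x ∉ Y)
    (hY : Even Y.card) : Avoidable Y H := by
  obtain ⟨m, hm⟩ := hY
  obtain ⟨J, hJ, hJc⟩ := Finset.exists_subset_card_eq (s := Y) (n := m) (by omega)
  apply Avoidable.of_coloring (h.crossGen.mono hYX) (fun z => z ∈ J)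
  · rw [Finset.filter_mem_eq_inter, Finset.inter_eq_right.2 hJ]
    omega
  · intro a ha b hb _ _ hab
    rcases hstar a b hab with rfl | rfl
    exacts [hx ha, hx hb]

theorem avoidable_of_star_of_even_side (h : BlockingTree n X T H) {x p : Pt}
    (hstar : ∀ a b, s(a, b) ∈ H → a = x ∨ b = x) (hpT : p ∉ T) {Y : Finset Pt} (hYX : Y ⊆ X)
    (hx : x ∈ Y) (hp : p ∈ Y) (hxp : x ≠ p) (hY : Even Y.card)
    (hside : Even (Y.filter fun z => cross p x z < 0).card) : Avoidable Y H := by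
  have hd : cross x p = fun z => -cross p x z := funext fun z => cross_swap p x z
  have hpair : ((Y.filter fun z => cross p x z ≤ 0).filter fun z => cross x p z ≤ 0) = {p, x} := by
    ext z
    simp only [Finset.mem_filter, Finset.mem_insert, Finset.mem_singleton, hd, neg_nonpos]
    constructor
    · rintro ⟨⟨hz, h1⟩, h2⟩
      by_contra! hzz
      exact h.crossGen p (hYX hp) x (hYX hx) z (hYX hz) hxp.symm hzz.1.symm hzz.2.symm
        (le_antisymm h1 h2)
    · rintro (rfl | rfl) <;> simp [hx, hp]
  have hneg : ((Y.filter fun z => cross p x z ≤ 0).filter fun z => 0 < cross x p z) =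
      Y.filter fun z => cross p x z < 0 := by
    ext z
    simp only [Finset.mem_filter, hd, neg_pos]
    constructor
    · tauto
    · exact fun hz => ⟨⟨hz.1, hz.2.le⟩, hz.2⟩
  have e1 := Finset.card_filter_add_card_filter_not (s := Y.filter fun z => cross p x z ≤ 0)
    (fun z => cross x p z ≤ 0)
  have e2 := Finset.card_filter_add_card_filter_not (s := Y) (fun z => cross p x z ≤ 0)
  simp only [not_le] at e1 e2
  rw [hpair, hneg, Finset.card_pair hxp.symm] at e1
  apply Avoidable.of_filter (preservesConvexComb_cross p x)
  · apply Avoidable.of_filter (preservesConvexComb_cross x p)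
    · rw [hpair]
      exact Avoidable.pair hxp.symm fun hH => hpT (h.mem_left hH)
    · rw [hneg]
      exact h.avoidable_of_star hstar ((Finset.filter_subset _ _).trans hYX) (by simp) hside
  · apply h.avoidable_of_star hstar ((Finset.filter_subset _ _).trans hYX) (by simp)
    rw [Nat.even_iff] at *
    omega

theorem exists_isHullEdge_of_star (h : BlockingTree n X T H) {x : Pt} (hxT : x ∈ T)
    (hstar : ∀ a b, s(a, b) ∈ H → a = x ∨ b = x) :
    (∃ b, IsHullEdge X x b) ∧ ∃ a, IsHullEdge X a x := by
  have hn := h.two_le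
  obtain ⟨p, hp⟩ := Finset.card_pos.1 (show 0 < (X \ T).card by rw [h.card_sdiff]; omega)
  rw [Finset.mem_sdiff] at hp
  have hxX := h.subset hxT
  have hxp : x ≠ p := fun e => hp.2 (e ▸ hxT)
  rcases exists_isHullEdge_beyond h.crossGen hxX hp.1 hxp with ⟨a, b, hab, ha, hb⟩ | h'
  · exfalso
    have hax : a ≠ x := by rintro rfl; simp at ha
    have hbx : b ≠ x := by rintro rfl; simp at hb
    have hap : a ≠ p := by rintro rfl; simp at ha
    have hbp : b ≠ p := by rintro rfl; simp at hb
    by_cases hev : Even (X.filter fun z => cross p x z < 0).card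
    · apply h.not_avoidable
      exact h.avoidable_of_star_of_even_side hstar hp.2 subset_rfl hxX hp.1 hxp
        (by rw [h.card_X]; simp) hev
    · have hr := h.isRemovable_of_isHullEdge hab
      apply hr.2.2.2
      · intro hH
        rcases hstar a b hH with h1 | h1
        exacts [hax h1, hbx h1]
      · apply h.avoidable_of_star_of_even_side hstar hp.2 Finset.sdiff_subset
          (by simp [hxX, hax.symm, hbx.symm]) (by simp [hp.1, hap.symm, hbp.symm]) hxp
        · rw [h.card_sdiff_pair hr]
          simp
        · have : ((X \ {a, b}).filter fun z => cross p x z < 0) =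
              (X.filter fun z => cross p x z < 0).erase a := by
            ext z
            simp only [Finset.mem_filter, Finset.mem_sdiff, Finset.mem_insert,
              Finset.mem_singleton, Finset.mem_erase]
            constructor
            · tauto
            · rintro ⟨h1, h2, h3⟩
              refine ⟨⟨h2, ?_⟩, h3⟩
              rintro (rfl | rfl)
              · exact h1 rfl
              · linarith
          have hmem : a ∈ X.filter fun z => cross p x z < 0 := Finset.mem_filter.2 ⟨hab.1, ha⟩
          have hpos := Finset.card_pos.2 ⟨a, hmem⟩
          rw [this, Finset.card_erase_of_mem hmem]
          rw [Nat.even_iff] at *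
          omega
  · exact h'

/-- A point of degree at least two is a vertex of the convex hull. -/
theorem exists_isHullEdge_of_inner (h : BlockingTree n X T H) {x y y' : Pt} (hy : s(x, y) ∈ H)
    (hy' : s(x, y') ∈ H) (hne : y ≠ y') :
    (∃ b, IsHullEdge X x b) ∧ ∃ a, IsHullEdge X a x := by
  by_cases hex : ∃ w, s(x, w) ∈ H ∧ ∃ b, b ≠ x ∧ s(w, b) ∈ H
  · obtain ⟨w, hw, hb⟩ := hex
    have hx : ∃ b, b ≠ w ∧ s(x, b) ∈ H := by
      by_cases hwy : y = w
      · exact ⟨y', hwy ▸ hne.symm, hy'⟩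
      · exact ⟨y, hwy, hy⟩
    rcases h.isHullEdge_of_inner_edge hw hx hb with h1 | h1
    · exact ⟨⟨w, h1⟩, h1.exists_left h.crossGen⟩
    · exact ⟨h1.exists_right h.crossGen, ⟨w, h1⟩⟩
  · push Not at hex
    have hxT := h.mem_left hy
    have hT := h.eq_of_closed (S := T.filter fun z => z = x ∨ s(x, z) ∈ H)
      (Finset.filter_subset _ _) ⟨x, by simp [hxT]⟩ (by
        intro a ha b hab
        rw [Finset.mem_filter] at ha ⊢
        refine ⟨h.mem_right hab, ?_⟩
        rcases ha.2 with rfl | h1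
        · exact Or.inr hab
        · left
          by_contra hbx
          exact hex a h1 b hbx hab)
    apply h.exists_isHullEdge_of_star hxT
    intro a b hab
    have ha := h.mem_left hab
    rw [← hT, Finset.mem_filter] at ha
    rcases ha.2 with h1 | h1
    · exact Or.inl h1
    · right
      by_contra hbx
      exact hex a h1 b hbx hab

/-- The line through `u` and `v` strictly separates `a` from `b`. -/
def Separates (u v a b : Pt) : Prop :=
  0 < cross u v a ∧ cross u v b < 0 ∨ cross u v a < 0 ∧ 0 < cross u v b

theorem Separates.comm {u v a b : Pt} (hs : Separates u v a b) : Separates u v b a := by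
  unfold Separates at *
  tauto

theorem Separates.swap {u v a b : Pt} (hs : Separates u v a b) : Separates v u a b := by
  unfold Separates at *
  simp only [cross_swap u v, neg_pos, neg_lt_zero]
  tauto

theorem not_separates_of_edge (h : BlockingTree n X T H) {u v a b : Pt} (hl : IsLeaf H u v)
    (hab : s(a, b) ∈ H) : ¬ Separates u v a b := by
  rintro (⟨h1, h2⟩ | ⟨h1, h2⟩)
  · exact h.not_crosses_leaf_line hl hab h1 h2
  · exact h.not_crosses_leaf_line hl (Sym2.eq_swap ▸ hab) h2 h1

theorem not_separates_of_sdiff_of_mem (h : BlockingTree n X T H) {p q u v : Pt}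
    (hpq : IsRemovable X H p q) (hp : p ∉ T) (hq : q ∈ T) (hl : IsLeaf H u v) :
    ¬ Separates u v p q := by
  intro hs
  have huT := h.mem_left hl.1
  have hvT := h.mem_right hl.1
  have huq : u ≠ q := by rintro rfl; simp [Separates] at hs
  have hvq : v ≠ q := by rintro rfl; simp [Separates] at hs
  have hup : u ≠ p := fun e => hp (e ▸ huT)
  have hvp : v ≠ p := fun e => hp (e ▸ hvT)
  have hvu := (h.ne hl.1).symm
  have hT := h.card_T
  have hbal := (h.balanced_of_isLeaf hl).1
  have hYX : X \ {p, q} ⊆ X := Finset.sdiff_subset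
  apply hpq.2.2.2 fun hH => hp (h.mem_left hH)
  apply Avoidable.of_unbalanced (h.crossGen.mono hYX) (fun z => z ∈ T \ {q, u})
    _ (u := u) (v := v) (by simp [h.subset huT, hup, huq]) (by simp [h.subset hvT, hvp, hvq])
    (by simp) (by simp [hvT, hvq, hvu])
  · intro a _ b hb ha hb' hab
    have hbT := h.mem_right hab
    simp only [Finset.mem_sdiff, Finset.mem_insert, Finset.mem_singleton, not_or, hbT,
      true_and] at hb hb' ha
    have : b = u := by tauto
    subst this
    exact ⟨hl.2 a (Sym2.eq_swap ▸ hab), rfl⟩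
  · have e1 : ((X \ {p, q}).filter fun z => 0 < cross u v z ∧ z ∈ T \ {q, u}) =
        (T.filter fun z => 0 < cross u v z).erase q := by
      ext z
      simp only [Finset.mem_filter, Finset.mem_sdiff, Finset.mem_insert, Finset.mem_singleton,
        Finset.mem_erase, not_or]
      constructor
      · tauto
      · rintro ⟨h1, h2, h3⟩
        refine ⟨⟨h.subset h2, ?_, h1⟩, h3, h2, h1, ?_⟩
        · rintro rfl; exact hp h2
        · rintro rfl; simp at h3
    have e2 : ((X \ {p, q}).filter fun z => 0 < cross u v z ∧ ¬ z ∈ T \ {q, u}) =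
        ((X \ T).filter fun z => 0 < cross u v z).erase p := by
      ext z
      simp only [Finset.mem_filter, Finset.mem_sdiff, Finset.mem_insert, Finset.mem_singleton,
        Finset.mem_erase, not_or]
      constructor
      · rintro ⟨⟨h1, h2, h2'⟩, h3, h4⟩
        refine ⟨h2, ⟨h1, fun hz => h4 ⟨hz, h2', ?_⟩⟩, h3⟩
        rintro rfl; simp at h3
      · rintro ⟨h1, ⟨h2, h2'⟩, h3⟩
        refine ⟨⟨h2, h1, ?_⟩, h3, fun hz => h2' hz.1⟩
        rintro rfl; exact h2' hq
    rw [e1, e2]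
    rcases hs with ⟨h1, h2⟩ | ⟨h1, h2⟩
    · have hm : p ∈ (X \ T).filter fun z => 0 < cross u v z := by simp [hpq.1, hp, h1]
      have := Finset.card_pos.2 ⟨p, hm⟩
      rw [Finset.erase_eq_of_notMem (s := T.filter _) (by simp [h2.le]),
        Finset.card_erase_of_mem hm]
      omega
    · have hm : q ∈ T.filter fun z => 0 < cross u v z := by simp [hq, h2]
      have := Finset.card_pos.2 ⟨q, hm⟩
      rw [Finset.erase_eq_of_notMem (s := (X \ T).filter _) (by simp [h1.le]),
        Finset.card_erase_of_mem hm]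
      omega
  · rw [h.card_sdiff_pair hpq, Finset.filter_mem_eq_inter]
    have : (X \ {p, q}) ∩ (T \ {q, u}) = T \ {q, u} := by
      rw [Finset.inter_eq_right]
      intro z
      simp only [Finset.mem_sdiff, Finset.mem_insert, Finset.mem_singleton, not_or]
      rintro ⟨h1, h2, h3⟩
      exact ⟨h.subset h1, fun e => hp (e ▸ h1), h2⟩
    rw [this, Finset.card_sdiff_of_subset (by simp [Finset.insert_subset_iff, hq, huT]), hT,
      Finset.card_pair huq.symm]
    omega

theorem neighbour_ne_of_isLeaf (h : BlockingTree n X T H) {u v u' v' : Pt} (hl : IsLeaf H u v)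
    (hl' : IsLeaf H u' v') : u' ≠ v := by
  rintro rfl
  obtain rfl := hl'.2 u (Sym2.eq_swap ▸ hl.1)
  have hT := h.eq_of_closed (S := {u, u'})
    (by simp [Finset.insert_subset_iff, h.mem_left hl.1, h.mem_right hl.1]) (by simp) (by
      intro a ha b hab
      simp only [Finset.mem_insert, Finset.mem_singleton] at ha ⊢
      rcases ha with rfl | rfl
      · exact Or.inr (hl.2 b hab)
      · exact Or.inl (hl'.2 b hab))
  have h1 := Finset.card_le_two (a := u) (b := u')
  have := h.card_T
  have := h.two_le
  rw [hT] at h1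
  omega

theorem not_crosses_leaf_line' (h : BlockingTree n X T H) {u v p q s t : Pt} (hl : IsLeaf H u v)
    (hpq : p = u ∧ q = v ∨ p = v ∧ q = u) (hst : s(s, t) ∈ H) (hs : 0 < cross p q s) :
    0 ≤ cross p q t := by
  by_contra! ht
  have : Separates p q s t := Or.inl ⟨hs, ht⟩
  rcases hpq with ⟨rfl, rfl⟩ | ⟨rfl, rfl⟩
  · exact h.not_separates_of_edge hl hst this
  · exact h.not_separates_of_edge hl hst this.swap

theorem cross_ne_zero_of_line (h : BlockingTree n X T H) {u v p q z : Pt} (hl : IsLeaf H u v)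
    (hpq : p = u ∧ q = v ∨ p = v ∧ q = u) (hz : z ∈ X) (hzu : z ≠ u) (hzv : z ≠ v) :
    cross p q z ≠ 0 := by
  have hu := h.subset (h.mem_left hl.1)
  have hv := h.subset (h.mem_right hl.1)
  rcases hpq with ⟨rfl, rfl⟩ | ⟨rfl, rfl⟩
  · exact h.crossGen _ hu _ hv _ hz (h.ne hl.1) hzu.symm hzv.symm
  · exact h.crossGen _ hv _ hu _ hz (h.ne hl.1).symm hzv.symm hzu.symm

theorem cross_step (h : BlockingTree n X T H) {u v u' v' p q p' q' z z' : Pt}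
    (hl : IsLeaf H u v) (hl' : IsLeaf H u' v') (hvv : v ≠ v')
    (hpq : p = u ∧ q = v ∨ p = v ∧ q = u) (hpq' : p' = u' ∧ q' = v' ∨ p' = v' ∧ q' = u')
    (hu : cross p' q' u < 0) (hzz : s(z, z') ∈ H)
    (hz : 0 < cross p q z) (hz' : 0 < cross p' q' z) : 0 < cross p q z' := by
  have huv := h.ne hl.1
  have h1 := h.not_crosses_leaf_line' hl hpq hzz hz
  refine h1.lt_of_ne (Ne.symm ?_)
  apply h.cross_ne_zero_of_line hl hpq (h.subset (h.mem_right hzz))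
  · rintro rfl
    obtain rfl := hl.2 z (Sym2.eq_swap ▸ hzz)
    rcases hpq with ⟨rfl, rfl⟩ | ⟨rfl, rfl⟩ <;> simp at hz
  · rintro rfl
    have h2 := h.not_crosses_leaf_line' hl' hpq' hzz hz'
    have h3 := h.cross_ne_zero_of_line hl' hpq' (h.subset (h.mem_right hzz))
      (h.neighbour_ne_of_isLeaf hl hl').symm hvv
    have := h.not_crosses_leaf_line' hl' hpq' (Sym2.eq_swap ▸ hl.1) (h2.lt_of_ne h3.symm)
    linarith

/-- The outer sides of two leaf lines have no point of `T` in common. -/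
theorem not_mem_outer_sides (h : BlockingTree n X T H) {u v u' v' p q p' q' z : Pt}
    (hl : IsLeaf H u v) (hl' : IsLeaf H u' v') (huu : u ≠ u')
    (hpq : p = u ∧ q = v ∨ p = v ∧ q = u) (hpq' : p' = u' ∧ q' = v' ∨ p' = v' ∧ q' = u')
    (hu' : cross p q u' < 0) (hu : cross p' q' u < 0) (hzT : z ∈ T)
    (hz : 0 < cross p q z) (hz' : 0 < cross p' q' z) : False := by
  by_cases hvv : v = v'
  · subst hvv
    obtain ⟨⟨y, hy⟩, -⟩ := h.exists_isHullEdge_of_inner (x := v) (Sym2.eq_swap ▸ hl.1)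
      (Sym2.eq_swap ▸ hl'.1) huu
    have huX := h.subset (h.mem_left hl.1)
    have hu'X := h.subset (h.mem_left hl'.1)
    have hnn : ∀ w ∈ X, 0 ≤ cross v y w := by
      intro w hw
      by_cases h1 : w = v
      · subst h1; simp
      by_cases h2 : w = y
      · subst h2; simp
      exact (hy.2.2.2 w hw h1 h2).le
    have hyz := hnn z (h.subset hzT)
    have hyu := hnn u huX
    have hyu' := hnn u' hu'X
    have hsum : 0 < cross v y u + cross v y u' := by
      by_cases h2 : u = y
      · have := hy.2.2.2 u' hu'X (h.ne hl'.1) (fun e => huu (h2.trans e.symm))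
        linarith
      · have := hy.2.2.2 u huX (h.ne hl.1) h2
        linarith
    have hid : cross v y z * cross v u u' =
        cross v z u' * cross v y u + cross v u z * cross v y u' := by
      simp only [cross]
      ring
    have hs1 : cross v u z * cross v u u' < 0 := by
      rcases hpq with ⟨rfl, rfl⟩ | ⟨rfl, rfl⟩
      · rw [cross_swap q p] at hz hu'
        nlinarith
      · nlinarith
    have hs2 : cross v z u' * cross v u u' < 0 := by
      have e1 : cross v u' u = -cross v u u' := by simp only [cross]; ring
      have e2 : cross v u' z = -cross v z u' := by simp only [cross]; ring
      rcases hpq' with ⟨rfl, rfl⟩ | ⟨rfl, rfl⟩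
      · rw [cross_swap q' p'] at hz' hu
        nlinarith
      · nlinarith
    have hid2 : cross v y z * cross v u u' ^ 2 =
        (cross v z u' * cross v u u') * cross v y u +
          (cross v u z * cross v u u') * cross v y u' := by
      linear_combination cross v u u' * hid
    have hl1 : 0 ≤ cross v y z * cross v u u' ^ 2 := by positivity
    rcases hyu.eq_or_lt with h0 | h0
    · nlinarith
    · nlinarith
  · have hT := h.eq_of_closed (S := T.filter fun z => 0 < cross p q z ∧ 0 < cross p' q' z)
      (Finset.filter_subset _ _) ⟨z, by simp [hzT, hz, hz']⟩ (by
        intro a ha b hab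
        rw [Finset.mem_filter] at ha ⊢
        exact ⟨h.mem_right hab, h.cross_step hl hl' hvv hpq hpq' hu hab ha.2.1 ha.2.2,
          h.cross_step hl' hl (Ne.symm hvv) hpq' hpq hu' hab ha.2.2 ha.2.1⟩)
    have := h.mem_left hl.1
    rw [← hT, Finset.mem_filter] at this
    linarith

theorem separates_line {u v p q a b : Pt} (hpq : p = u ∧ q = v ∨ p = v ∧ q = u)
    (hs : Separates u v a b) : Separates p q a b := by
  rcases hpq with ⟨rfl, rfl⟩ | ⟨rfl, rfl⟩
  exacts [hs, hs.swap]

theorem exists_oriented_line (h : BlockingTree n X T H) {u v z : Pt} (hl : IsLeaf H u v)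
    (hz : z ∈ X) (hzu : z ≠ u) (hzv : z ≠ v) :
    ∃ p q, (p = u ∧ q = v ∨ p = v ∧ q = u) ∧ cross p q z < 0 := by
  rcases (h.cross_ne_zero_of_line hl (Or.inl ⟨rfl, rfl⟩) hz hzu hzv).lt_or_gt with h1 | h1
  · exact ⟨u, v, Or.inl ⟨rfl, rfl⟩, h1⟩
  · exact ⟨v, u, Or.inr ⟨rfl, rfl⟩, by rw [cross_swap]; linarith⟩

theorem balanced_line (h : BlockingTree n X T H) {u v p q : Pt} (hl : IsLeaf H u v)
    (hpq : p = u ∧ q = v ∨ p = v ∧ q = u) : Balanced X T p q := by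
  rcases hpq with ⟨rfl, rfl⟩ | ⟨rfl, rfl⟩
  exacts [h.balanced_of_isLeaf hl, (h.balanced_of_isLeaf hl).symm]

theorem cross_leaf_eq_zero {u v p q : Pt} (hpq : p = u ∧ q = v ∨ p = v ∧ q = u) :
    cross p q u = 0 ∧ cross p q v = 0 := by
  rcases hpq with ⟨rfl, rfl⟩ | ⟨rfl, rfl⟩ <;> simp

theorem false_of_separates_sdiff (h : BlockingTree n X T H) {a b u v u' v' p q p' q' : Pt}
    (hab : IsRemovable X H a b) (ha : a ∉ T) (hb : b ∉ T) (hl : IsLeaf H u v)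
    (hl' : IsLeaf H u' v') (huu : u ≠ u')
    (hpq : p = u ∧ q = v ∨ p = v ∧ q = u) (hpq' : p' = u' ∧ q' = v' ∨ p' = v' ∧ q' = u')
    (hu' : cross p q u' < 0) (hu : cross p' q' u < 0)
    (hfa : 0 < cross p q a) (hfb : cross p q b < 0) (hg : Separates p' q' a b) : False := by
  have huT := h.mem_left hl.1
  have hvT := h.mem_right hl.1
  have huT' := h.mem_left hl'.1
  have hT := h.card_T
  have huX := h.subset huT
  have huv := h.ne hl.1
  have huv' := h.ne hl'.1
  obtain ⟨hfu, hfv⟩ := cross_leaf_eq_zero hpq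
  obtain ⟨hgu', hgv'⟩ := cross_leaf_eq_zero hpq'
  have hbal := (h.balanced_line hl hpq).1
  have hbal' := (h.balanced_line hl' hpq').1
  have hua : u ≠ a := fun e => ha (e ▸ huT)
  have hub : u ≠ b := fun e => hb (e ▸ huT)
  have hu'a : u' ≠ a := fun e => ha (e ▸ huT')
  have hu'b : u' ≠ b := fun e => hb (e ▸ huT')
  have hYX : X \ {a, b} ⊆ X := Finset.sdiff_subset
  set c : Pt → Prop := fun z => z ∈ T ∧ z ≠ u ∧ z ≠ u' with hc
  set L := insert u ((X.filter fun z => 0 < cross p q z).erase a) with hL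
  have hLmem : ∀ z, z ∈ L ↔ z = u ∨ z ≠ a ∧ z ∈ X ∧ 0 < cross p q z := by
    intro z
    simp [hL]
  have hLY : L ⊆ X \ {a, b} := by
    intro z hz
    rw [hLmem] at hz
    simp only [Finset.mem_sdiff, Finset.mem_insert, Finset.mem_singleton, not_or]
    rcases hz with rfl | ⟨h1, h2, h3⟩
    · exact ⟨huX, hua, hub⟩
    · exact ⟨h2, h1, by rintro rfl; linarith⟩
  have hLcard : L.card = 2 * (T.filter fun z => 0 < cross p q z).card := by
    have hm : a ∈ X.filter fun z => 0 < cross p q z := by simp [hab.1, hfa]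
    have := Finset.card_pos.2 ⟨a, hm⟩
    rw [hL, Finset.card_insert_of_notMem (by simp [hfu]), Finset.card_erase_of_mem hm]
    have := h.card_filter fun z => 0 < cross p q z
    omega
  have hLc : (L.filter c) = T.filter fun z => 0 < cross p q z := by
    ext z
    simp only [Finset.mem_filter, hLmem, hc]
    constructor
    · tauto
    · rintro ⟨h1, h2⟩
      refine ⟨Or.inr ⟨?_, h.subset h1, h2⟩, h1, ?_, ?_⟩
      · rintro rfl; exact ha h1
      · rintro rfl; linarith
      · rintro rfl; linarith
  have hYc : (X \ {a, b}).filter c = T \ {u, u'} := by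
    ext z
    simp only [Finset.mem_filter, Finset.mem_sdiff, Finset.mem_insert, Finset.mem_singleton,
      not_or, hc]
    constructor
    · tauto
    · rintro ⟨h1, h2, h3⟩
      exact ⟨⟨h.subset h1, fun e => ha (e ▸ h1), fun e => hb (e ▸ h1)⟩, h1, h2, h3⟩
  have hYccard : (T \ {u, u'}).card = n - 1 := by
    rw [Finset.card_sdiff_of_subset (by simp [Finset.insert_subset_iff, huT, huT']), hT,
      Finset.card_pair huu]
    omega
  have hYcard := h.card_sdiff_pair hab
  apply hab.2.2.2 fun hH => ha (h.mem_left hH)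
  have hpc := preservesConvexComb_cross p q
  have hpa := preservesConvexComb_along v u
  have huni : L ∪ ((X \ {a, b}) \ L) = X \ {a, b} := Finset.union_sdiff_of_subset hLY
  rw [← huni]
  refine Avoidable.union (C₁ := {z | 0 < cross p q z ∨ cross p q z = 0 ∧ 0 < along v u z})
    (C₂ := {z | 0 < -cross p q z ∨ -cross p q z = 0 ∧ 0 ≤ -along v u z}) ?_ ?_
    (hpc.convex_lex_pos hpa) (hpc.neg.convex_lex_nonneg hpa.neg) ?_ ?_ ?_
  · apply Avoidable.of_coloring (h.crossGen.mono (hLY.trans hYX)) c (by rw [hLc, hLcard])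
    intro x hx y hy hcx hcy hxy
    have hyT := h.mem_right hxy
    have : y = u ∨ y = u' := by
      by_contra! hh
      exact hcy ⟨hyT, hh⟩
    rcases this with rfl | rfl
    · obtain rfl := hl.2 x (Sym2.eq_swap ▸ hxy)
      rcases (hLmem _).1 hx with e | e
      · exact huv e.symm
      · linarith [e.2.2]
    · rcases (hLmem _).1 hy with e | e
      · exact huu e.symm
      · linarith [e.2.2]
  · set Y := (X \ {a, b}) \ L with hY
    have hYsub : Y ⊆ X := Finset.sdiff_subset.trans hYX
    have hbal2 : 2 * (Y.filter c).card = Y.card := by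
      have h1 : Y.filter c = (X \ {a, b}).filter c \ L.filter c := by
        ext z
        simp only [hY, Finset.mem_filter, Finset.mem_sdiff]
        tauto
      rw [h1, Finset.card_sdiff_of_subset (Finset.filter_subset_filter _ hLY),
        hY, Finset.card_sdiff_of_subset hLY, hLc, hLcard, hYc, hYccard, hYcard]
      omega
    have hedge : ∀ x ∈ Y, ∀ y ∈ Y, c x → ¬ c y → s(x, y) ∈ H → x = v' ∧ y = u' := by
      intro x _ y hy _ hcy hxy
      have hyT := h.mem_right hxy
      have : y = u ∨ y = u' := by
        by_contra! hh
        exact hcy ⟨hyT, hh⟩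
      rcases this with rfl | rfl
      · exact absurd ((hLmem _).2 (Or.inl rfl)) (Finset.mem_sdiff.1 hy).2
      · exact ⟨hl'.2 x (Sym2.eq_swap ▸ hxy), rfl⟩
    by_cases hv'Y : v' ∈ Y
    · have hu'Y : u' ∈ Y := by
        rw [hY, Finset.mem_sdiff, hLmem]
        refine ⟨by simp [h.subset huT', hu'a, hu'b], ?_⟩
        rintro (e | e)
        · exact huu e.symm
        · linarith [e.2.2]
      refine Avoidable.of_unbalanced_line (h.crossGen.mono hYsub) c hbal2 hu'Y hv'Y
        (fun e => e.2.2 rfl)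
        ⟨h.mem_right hl'.1, (h.neighbour_ne_of_isLeaf hl' hl).symm, huv'.symm⟩ hpq' hedge ?_
      have e1 : (T.filter fun z => 0 < cross p' q' z) ⊆
          Y.filter fun z => 0 < cross p' q' z ∧ c z := by
        intro z hz
        rw [Finset.mem_filter] at hz ⊢
        obtain ⟨hzT, hz⟩ := hz
        have hzu : z ≠ u := by rintro rfl; linarith
        have hzu' : z ≠ u' := by rintro rfl; linarith
        refine ⟨?_, hz, hzT, hzu, hzu'⟩
        rw [hY, Finset.mem_sdiff, hLmem]
        refine ⟨?_, ?_⟩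
        · simp only [Finset.mem_sdiff, Finset.mem_insert, Finset.mem_singleton, not_or]
          exact ⟨h.subset hzT, fun e => ha (e ▸ hzT), fun e => hb (e ▸ hzT)⟩
        · rintro (e | e)
          · exact hzu e
          · exact h.not_mem_outer_sides hl hl' huu hpq hpq' hu' hu hzT e.2.2 hz
      have e2 : ∀ w ∈ X \ T, (w = a ∨ w = b) → 0 < cross p' q' w →
          (Y.filter fun z => 0 < cross p' q' z ∧ ¬ c z).card <
          ((X \ T).filter fun z => 0 < cross p' q' z).card := by
        intro w hw hwab hgw
        apply Finset.card_lt_card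
        rw [Finset.ssubset_iff_of_subset]
        · refine ⟨w, Finset.mem_filter.2 ⟨hw, hgw⟩, fun hh => ?_⟩
          have := (Finset.mem_sdiff.1 (Finset.mem_sdiff.1 (Finset.mem_filter.1 hh).1).1).2
          rcases hwab with rfl | rfl <;> simp at this
        · intro z hz
          rw [Finset.mem_filter] at hz ⊢
          refine ⟨Finset.mem_sdiff.2 ⟨hYsub hz.1, fun hzT => hz.2.2 ⟨hzT, ?_, ?_⟩⟩, hz.2.1⟩
          · rintro rfl; linarith [hz.2.1]
          · rintro rfl; linarith [hz.2.1]
      have h1 := Finset.card_le_card e1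
      have h2 : (Y.filter fun z => 0 < cross p' q' z ∧ ¬ c z).card <
          ((X \ T).filter fun z => 0 < cross p' q' z).card := by
        rcases hg with hg | hg
        · exact e2 a (Finset.mem_sdiff.2 ⟨hab.1, ha⟩) (Or.inl rfl) hg.1
        · exact e2 b (Finset.mem_sdiff.2 ⟨hab.2.1, hb⟩) (Or.inr rfl) hg.2
      omega
    · apply Avoidable.of_coloring (h.crossGen.mono hYsub) c hbal2
      intro x hx y hy hcx hcy hxy
      exact hv'Y ((hedge x hx y hy hcx hcy hxy).1 ▸ hx)
  · rw [Set.disjoint_left]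
    intro z hz hz'
    simp only [Set.mem_ofPred_eq] at hz hz'
    rcases hz with hz | ⟨hz, h1⟩ <;> rcases hz' with hz' | ⟨hz', h2⟩ <;> linarith
  · intro z hz
    simp only [Set.mem_ofPred_eq]
    rcases (hLmem z).1 hz with rfl | hz
    · refine Or.inr ⟨hfu, ?_⟩
      have := sq_dist_pos huv.symm
      simp only [along]
      nlinarith
    · exact Or.inl hz.2.2
  · intro z hz
    simp only [Set.mem_ofPred_eq]
    have hzL := (Finset.mem_sdiff.1 hz).2
    have hzX := hYX (Finset.mem_sdiff.1 hz).1
    have hza : z ≠ a := by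
      rintro rfl
      simpa using (Finset.mem_sdiff.1 hz).1
    rw [hLmem] at hzL
    push Not at hzL
    by_cases hzv : z = v
    · subst hzv
      exact Or.inr ⟨by simp [hfv], by simp [along]⟩
    · left
      have h1 := h.cross_ne_zero_of_line hl hpq hzX hzL.1 hzv
      have := (hzL.2 hza hzX).lt_of_ne h1
      linarith

theorem not_separates_of_sdiff_sdiff (h : BlockingTree n X T H) {a b u v u' v' : Pt}
    (hab : IsRemovable X H a b) (ha : a ∉ T) (hb : b ∉ T) (hl : IsLeaf H u v)
    (hl' : IsLeaf H u' v') (huu : u ≠ u') (hs : Separates u v a b) : ¬ Separates u' v' a b := by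
  intro hs'
  obtain ⟨p, q, hpq, hu'⟩ := h.exists_oriented_line hl (h.subset (h.mem_left hl'.1)) huu.symm
    (h.neighbour_ne_of_isLeaf hl hl')
  obtain ⟨p', q', hpq', hu⟩ := h.exists_oriented_line hl' (h.subset (h.mem_left hl.1)) huu
    (h.neighbour_ne_of_isLeaf hl' hl)
  have hg := separates_line hpq' hs'
  rcases separates_line hpq hs with hf | hf
  · exact h.false_of_separates_sdiff hab ha hb hl hl' huu hpq hpq' hu' hu hf.1 hf.2 hg
  · exact h.false_of_separates_sdiff hab.symm hb ha hl hl' huu hpq hpq' hu' hu hf.2 hf.1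
      hg.comm

/-- A removable pair is met by the line of at most one leaf edge. -/
theorem eq_of_meets (h : BlockingTree n X T H) {a b u v u' v' : Pt}
    (hab : IsRemovable X H a b) (hl : IsLeaf H u v) (hl' : IsLeaf H u' v')
    (hs : Separates u v a b ∨ u = a ∨ u = b) (hs' : Separates u' v' a b ∨ u' = a ∨ u' = b) :
    u = u' := by
  by_contra huu
  have huT := h.mem_left hl.1
  have huT' := h.mem_left hl'.1
  by_cases ha : a ∈ T <;> by_cases hb : b ∈ T
  · have hH := h.mem_of_isRemovable hab ha hb
    have hH' : s(b, a) ∈ H := Sym2.eq_swap ▸ hH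
    rcases hs with hs | rfl | rfl
    · exact h.not_separates_of_edge hl hH hs
    · rcases hs' with hs' | rfl | rfl
      · exact h.not_separates_of_edge hl' hH hs'
      · exact huu rfl
      · exact h.neighbour_ne_of_isLeaf hl hl' (hl.2 _ hH)
    · rcases hs' with hs' | rfl | rfl
      · exact h.not_separates_of_edge hl' hH hs'
      · exact h.neighbour_ne_of_isLeaf hl hl' (hl.2 _ hH')
      · exact huu rfl
  · have k : ∀ {w w'}, IsLeaf H w w' → (Separates w w' a b ∨ w = a ∨ w = b) → w = a := by
      intro w w' hw hws
      rcases hws with hws | e | rfl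
      · exact absurd hws.comm (h.not_separates_of_sdiff_of_mem hab.symm hb ha hw)
      · exact e
      · exact absurd (h.mem_left hw.1) hb
    exact huu ((k hl hs).trans (k hl' hs').symm)
  · have k : ∀ {w w'}, IsLeaf H w w' → (Separates w w' a b ∨ w = a ∨ w = b) → w = b := by
      intro w w' hw hws
      rcases hws with hws | rfl | e
      · exact absurd hws (h.not_separates_of_sdiff_of_mem hab ha hb hw)
      · exact absurd (h.mem_left hw.1) ha
      · exact e
    exact huu ((k hl hs).trans (k hl' hs').symm)
  · have k : ∀ {w w'}, IsLeaf H w w' → (Separates w w' a b ∨ w = a ∨ w = b) →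
        Separates w w' a b := by
      intro w w' hw hws
      rcases hws with hws | rfl | rfl
      · exact hws
      · exact absurd (h.mem_left hw.1) ha
      · exact absurd (h.mem_left hw.1) hb
    exact h.not_separates_of_sdiff_sdiff hab ha hb hl hl' huu (k hl hs) (k hl' hs')

/-- `x` has at least two neighbours in `H`. -/
def IsInner (H : Finset (Sym2 Pt)) (x : Pt) : Prop :=
  ∃ y y', s(x, y) ∈ H ∧ s(x, y') ∈ H ∧ y ≠ y'

theorem IsInner.ne_of_isLeaf {x u v : Pt} (hx : IsInner H x) (hl : IsLeaf H u v) : x ≠ u := by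
  rintro rfl
  obtain ⟨y, y', h1, h2, hne⟩ := hx
  exact hne ((hl.2 y h1).trans (hl.2 y' h2).symm)

theorem mem_of_isRemovable_of_isInner (h : BlockingTree n X T H) {x y : Pt}
    (hxy : IsRemovable X H x y) (hx : IsInner H x) : s(x, y) ∈ H := by
  obtain ⟨z, z', h1, h2, hne⟩ := hx
  exact h.mem_of_isRemovable hxy (h.mem_left h1)
    (h.mem_of_isRemovable_of_inner hxy.symm h1 h2 hne)

theorem isHullEdge_asymm (h : BlockingTree n X T H) {a b : Pt} (hab : IsHullEdge X a b) :
    ¬ IsHullEdge X b a := by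
  intro hba
  have h1 := Finset.card_le_card (hab.subset_of_symm hba)
  have h2 := Finset.card_le_two (a := a) (b := b)
  have := h.card_X
  have := h.two_le
  omega

/-- Some leaf immediately precedes an inner vertex on the boundary of the convex hull. -/
theorem exists_isLeaf_isHullEdge (h : BlockingTree n X T H) :
    ∃ u v x, IsLeaf H u v ∧ IsInner H x ∧ IsHullEdge X u x := by
  by_contra! hno
  have hex : ∀ x ∈ T, ∃ e ∈ H, (IsInner H x ∧ ∃ w, IsInner H w ∧ IsHullEdge X w x ∧ e = s(w, x)) ∨
      ∃ v, IsLeaf H x v ∧ e = s(x, v) := by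
    intro x hx
    rcases h.isLeaf_or_inner hx with ⟨v, hv⟩ | ⟨y, y', h1, h2, hne⟩
    · exact ⟨_, hv.1, Or.inr ⟨v, hv, rfl⟩⟩
    · have hin : IsInner H x := ⟨y, y', h1, h2, hne⟩
      obtain ⟨-, w, hw⟩ := h.exists_isHullEdge_of_inner h1 h2 hne
      have hH := h.mem_of_isRemovable_of_isInner (h.isRemovable_of_isHullEdge hw).symm hin
      refine ⟨_, Sym2.eq_swap ▸ hH, Or.inl ⟨hin, w, ?_, hw, rfl⟩⟩
      rcases h.isLeaf_or_inner (h.mem_right hH) with ⟨v, hv⟩ | hw'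
      · exact absurd hw (hno w v x hv hin)
      · exact hw'
  choose! e heH he using hex
  have hcard : T.card ≤ H.card := by
    apply Finset.card_le_card_of_injOn e heH
    intro x hx x' hx' hxx
    rcases he x hx with ⟨hin, w, hw, hwx, e1⟩ | ⟨v, hv, e1⟩ <;>
      rcases he x' hx' with ⟨hin', w', hw', hwx', e2⟩ | ⟨v', hv', e2⟩ <;>
      rw [e1, e2, Sym2.eq_iff] at hxx <;> rcases hxx with ⟨h1, h2⟩ | ⟨h1, h2⟩
    · exact h2
    · subst h1 h2
      exact absurd hwx (h.isHullEdge_asymm hwx')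
    · exact absurd h1 (hw.ne_of_isLeaf hv')
    · exact absurd h2 (hin.ne_of_isLeaf hv')
    · exact absurd h1.symm (hw'.ne_of_isLeaf hv)
    · exact absurd h1.symm (hin'.ne_of_isLeaf hv)
    · exact h1
    · exact absurd h1 (h.neighbour_ne_of_isLeaf hv' hv)
  have := h.card_T
  have := h.card_H
  omega

theorem exists_isHullEdge_of_mem (h : BlockingTree n X T H) {x : Pt} (hx : x ∈ T) :
    ∃ d : Pt × Pt, IsHullEdge X d.1 d.2 ∧ (IsInner H x ∧ d.1 = x ∨
      ∃ v, IsLeaf H x v ∧ (Separates x v d.1 d.2 ∨ d.1 = x)) := by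
  rcases h.isLeaf_or_inner hx with ⟨v, hv⟩ | ⟨y, y', h1, h2, hne⟩
  · rcases exists_isHullEdge_beyond h.crossGen (h.subset hx) (h.subset (h.mem_right hv.1))
      (h.ne hv.1) with ⟨a, b, hab, h1, h2⟩ | ⟨⟨b, hb⟩, -⟩
    · exact ⟨(a, b), hab, Or.inr ⟨v, hv, Or.inl (Separates.swap (Or.inr ⟨h1, h2⟩))⟩⟩
    · exact ⟨(x, b), hb, Or.inr ⟨v, hv, Or.inr rfl⟩⟩
  · obtain ⟨⟨b, hb⟩, -⟩ := h.exists_isHullEdge_of_inner h1 h2 hne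
    exact ⟨(x, b), hb, Or.inl ⟨⟨y, y', h1, h2, hne⟩, rfl⟩⟩

theorem not_meets_of_isInner (h : BlockingTree n X T H) {d : Pt × Pt} {u v : Pt}
    (hd : IsHullEdge X d.1 d.2) (hin : IsInner H d.1) (hl : IsLeaf H u v) :
    ¬ (Separates u v d.1 d.2 ∨ d.1 = u) := by
  rintro (hs | hs)
  · exact h.not_separates_of_edge hl
      (h.mem_of_isRemovable_of_isInner (h.isRemovable_of_isHullEdge hd) hin) hs
  · exact hin.ne_of_isLeaf hl hs

theorem lt_ncard_extremePoints (h : BlockingTree n X T H) :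
    n + 1 < ((X : Set Pt) ∩ Set.extremePoints ℝ (convexHull ℝ (X : Set Pt))).ncard := by
  have hex := fun x (hx : x ∈ T) => h.exists_isHullEdge_of_mem hx
  choose! d hd hdx using hex
  have hinj : Set.InjOn d T := by
    intro x hx x' hx' hxx
    have hdd := hd x hx
    rcases hdx x hx with ⟨hin, e1⟩ | ⟨v, hv, hs⟩ <;>
      rcases hdx x' hx' with ⟨hin', e2⟩ | ⟨v', hv', hs'⟩
    · rw [← e1, ← e2, hxx]
    · rw [← hxx] at hs'
      exact absurd hs' (h.not_meets_of_isInner hdd (by rwa [e1]) hv')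
    · rw [hxx] at hs hdd
      exact absurd hs (h.not_meets_of_isInner hdd (by rwa [e2]) hv)
    · rw [← hxx] at hs'
      exact h.eq_of_meets (h.isRemovable_of_isHullEdge hdd) hv hv'
        (hs.imp_right fun e => Or.inl e.symm) (hs'.imp_right fun e => Or.inl e.symm)
  obtain ⟨u, v, x, hl, hin, hux⟩ := h.exists_isLeaf_isHullEdge
  obtain ⟨a, hau⟩ := hux.exists_left h.crossGen
  have hnot : (a, u) ∉ T.image d := by
    intro hmem
    obtain ⟨w, hw, hdw⟩ := Finset.mem_image.1 hmem
    have hrem := h.isRemovable_of_isHullEdge hau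
    rcases hdx w hw with ⟨hinw, e1⟩ | ⟨v', hv', hs⟩
    · rw [hdw] at e1
      subst e1
      have h1 := h.mem_of_isRemovable_of_isInner hrem hinw
      have h2 := h.mem_of_isRemovable_of_isInner (h.isRemovable_of_isHullEdge hux).symm hin
      have : a = x := (hl.2 a (Sym2.eq_swap ▸ h1)).trans (hl.2 x (Sym2.eq_swap ▸ h2)).symm
      subst this
      exact h.isHullEdge_asymm hau hux
    · rw [hdw] at hs
      have := h.eq_of_meets hrem hv' hl (hs.imp_right fun e => Or.inl e.symm)
        (Or.inr (Or.inr rfl))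
      subst this
      rcases hs with hs | hs
      · simp [Separates] at hs
      · exact hau.2.2.1 hs
  have hle := card_le_ncard_extremePoints (X := X) (insert (a, u) (T.image d)) (by
    intro e he
    rcases Finset.mem_insert.1 he with rfl | he
    · exact hau
    · obtain ⟨w, hw, rfl⟩ := Finset.mem_image.1 he
      exact hd w hw)
  rw [Finset.card_insert_of_notMem hnot, Finset.card_image_of_injOn hinj, h.card_T] at hle
  omega

end BlockingTree

/-- Claim `cross`: if at most `n+1` points of `X` are extreme points of its
convex hull and `H` is a set of exactly `n` edges eliminating all non-crossing perfect matchings,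
then for every leaf edge `{u,v}` of `H`, no other edge of `H` meets the line through `u` and
`v`. -/
theorem leaf_edge_line_meets_no_other_edge (n : ℕ) (X : Finset Pt)
    (hXcard : X.card = 2 * n) (hgp : GenPos X)
    (hhull : ((X : Set Pt) ∩ Set.extremePoints ℝ (convexHull ℝ (X : Set Pt))).ncard ≤ n + 1)
    (H : Finset (Sym2 Pt)) (hH : ∀ e ∈ H, IsEdgeOf X e) (hHcard : H.card = n)
    (helim : ∀ M : Finset (Sym2 Pt), IsNCMatching X M → ¬ Avoids M H)
    (u v : Pt) (huv : s(u, v) ∈ H)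
    (hleaf : (∀ e ∈ H, u ∈ e → e = s(u, v)) ∨ (∀ e ∈ H, v ∈ e → e = s(u, v))) :
    ∀ x y : Pt, s(x, y) ∈ H → s(x, y) ≠ s(u, v) →
      Disjoint (segment ℝ x y) {w : Pt | cross u v w = 0} := by
  intro x y hxy hne
  exfalso
  have hle : ¬ n ≤ 1 := by
    intro hn
    have h1 := Finset.card_le_card (s := {s(x, y), s(u, v)}) (t := H)
      (by simp [Finset.insert_subset_iff, hxy, huv])
    rw [Finset.card_pair hne] at h1
    omega
  have hbl : ¬ Avoidable X H := fun ⟨M, hM, ha⟩ => helim M hM ha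
  obtain ⟨T, hTX, hT, hHT⟩ :=
    exists_support_of_not_avoidable (by omega) hgp.crossGen hXcard hH hHcard hbl
  have hB : BlockingTree n X T H :=
    { two_le := by omega
      crossGen := hgp.crossGen
      card_X := hXcard
      subset := hTX
      card_T := hT
      mem_left := fun {a b} hab => hHT a b hab
      ne := fun {a b} hab => by simpa using (hH _ hab).1
      card_H := hHcard
      not_avoidable := hbl }
  exact absurd hB.lt_ncard_extremePoints (not_lt.2 hhull)
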